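/- Let ρ_{E_AE_B} be a bipartite state (possibly mixed) preshared between sender and receiver and N_{A→B} a quantum channel. For every ε ∈ [0,1), the ρ-assisted ε-classical capacity of N with semi-global encoding operations satisfies the strong converse bound C^{π,ε}_ρ(N) ≤ I_ρ(N); equivalently, for any sequence of semi-global codes with rate exceeding I_ρ(N), the success probability decays exponentially to zero in the blocklength. -/

import Mathlib

open scoped Kronecker ComplexOrder
open Matrix

noncomputable section

namespace QIT

/-- Base-2 logarithm of a Hermitian matrix, via the spectral theorem
(junk value `0` on non-Hermitian inputs). -/
def matLog {ι : Type*} [Fintype ι] [DecidableEq ι] (ρ : Matrix ι ι ℂ) : Matrix ι ι ℂ :=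
  if h : ρ.IsHermitian then
    (h.eigenvectorUnitary : Matrix ι ι ℂ) *
      Matrix.diagonal (fun i => (Real.logb 2 (h.eigenvalues i) : ℂ)) *
      star (h.eigenvectorUnitary : Matrix ι ι ℂ)
  else 0

/-- Von Neumann entropy (base 2): `S(ρ) = -tr[ρ log ρ]`. -/
def entropy {ι : Type*} [Fintype ι] [DecidableEq ι] (ρ : Matrix ι ι ℂ) : ℝ :=
  -(ρ * matLog ρ).trace.re

/-- Quantum relative entropy (base 2): `D(ρ‖σ) = tr[ρ (log ρ - log σ)]`. -/
def relEnt {ι : Type*} [Fintype ι] [DecidableEq ι] (ρ σ : Matrix ι ι ℂ) : ℝ :=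
  (ρ * (matLog ρ - matLog σ)).trace.re

/-- A quantum state: positive semidefinite with unit trace. -/
def IsState {ι : Type*} [Fintype ι] (ρ : Matrix ι ι ℂ) : Prop :=
  ρ.PosSemidef ∧ ρ.trace = 1

/-- A pure state: a rank-one outer product `|v⟩⟨v|`. -/
def IsPure {ι : Type*} [Fintype ι] (ρ : Matrix ι ι ℂ) : Prop :=
  ∃ v : ι → ℂ, ρ = Matrix.vecMulVec v (star v)

/-- Partial trace over the second (right) tensor factor. -/
def ptrR {α β : Type*} [Fintype β] (ρ : Matrix (α × β) (α × β) ℂ) : Matrix α α ℂ :=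
  Matrix.of fun a a' => ∑ b, ρ (a, b) (a', b)

/-- Partial trace over the first (left) tensor factor. -/
def ptrL {α β : Type*} [Fintype α] (ρ : Matrix (α × β) (α × β) ℂ) : Matrix β β ℂ :=
  Matrix.of fun b b' => ∑ a, ρ (a, b) (a, b')

/-- Quantum mutual information `I(A:B) = S(ρ_A) + S(ρ_B) - S(ρ_{AB})` (entropy form). -/
def mutualInfoS {α β : Type*} [Fintype α] [DecidableEq α] [Fintype β] [DecidableEq β]
    (ρ : Matrix (α × β) (α × β) ℂ) : ℝ :=
  entropy (ptrR ρ) + entropy (ptrL ρ) - entropy ρ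

/-- Quantum mutual information `I(A:B) = D(ρ_{AB} ‖ ρ_A ⊗ ρ_B)` (relative-entropy form). -/
def mutualInfoD {α β : Type*} [Fintype α] [DecidableEq α] [Fintype β] [DecidableEq β]
    (ρ : Matrix (α × β) (α × β) ℂ) : ℝ :=
  relEnt ρ (ptrR ρ ⊗ₖ ptrL ρ)

/-- Tensoring a linear map on matrices with the identity on the left: `id_γ ⊗ L`. -/
def lTensor {α β : Type*} (γ : Type*) (L : Matrix α α ℂ →ₗ[ℂ] Matrix β β ℂ) :
    Matrix (γ × α) (γ × α) ℂ →ₗ[ℂ] Matrix (γ × β) (γ × β) ℂ where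
  toFun ρ := Matrix.of fun p q => L (Matrix.of fun a a' => ρ (p.1, a) (q.1, a')) p.2 q.2
  map_add' ρ σ := by
    ext p q
    have h : (Matrix.of fun a a' => ρ (p.1, a) (q.1, a') + σ (p.1, a) (q.1, a')) =
        (Matrix.of fun a a' => ρ (p.1, a) (q.1, a')) +
          Matrix.of fun a a' => σ (p.1, a) (q.1, a') := rfl
    simp only [Matrix.of_apply, Matrix.add_apply, h, map_add]
  map_smul' c ρ := by
    ext p q
    have h : (Matrix.of fun a a' => c * ρ (p.1, a) (q.1, a')) =
        c • Matrix.of fun a a' => ρ (p.1, a) (q.1, a') := rfl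
    simp only [Matrix.of_apply, Matrix.smul_apply, smul_eq_mul, RingHom.id_apply, h,
      _root_.map_smul]

/-- Tensoring a linear map on matrices with the identity on the right: `L ⊗ id_γ`. -/
def rTensor {α β : Type*} (γ : Type*) (L : Matrix α α ℂ →ₗ[ℂ] Matrix β β ℂ) :
    Matrix (α × γ) (α × γ) ℂ →ₗ[ℂ] Matrix (β × γ) (β × γ) ℂ where
  toFun ρ := Matrix.of fun p q => L (Matrix.of fun a a' => ρ (a, p.2) (a', q.2)) p.1 q.1
  map_add' ρ σ := by
    ext p q
    have h : (Matrix.of fun a a' => ρ (a, p.2) (a', q.2) + σ (a, p.2) (a', q.2)) =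
        (Matrix.of fun a a' => ρ (a, p.2) (a', q.2)) +
          Matrix.of fun a a' => σ (a, p.2) (a', q.2) := rfl
    simp only [Matrix.of_apply, Matrix.add_apply, h, map_add]
  map_smul' c ρ := by
    ext p q
    have h : (Matrix.of fun a a' => c * ρ (a, p.2) (a', q.2)) =
        c • Matrix.of fun a a' => ρ (a, p.2) (a', q.2) := rfl
    simp only [Matrix.of_apply, Matrix.smul_apply, smul_eq_mul, RingHom.id_apply, h,
      _root_.map_smul]

/-- A quantum channel: a completely positive trace-preserving linear map. -/
structure QChannel (α β : Type*) [Fintype α] [DecidableEq α] [Fintype β] [DecidableEq β] where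
  map : Matrix α α ℂ →ₗ[ℂ] Matrix β β ℂ
  cp : ∀ (n : ℕ) (ρ : Matrix (Fin n × α) (Fin n × α) ℂ), ρ.PosSemidef →
    ((lTensor (Fin n) map) ρ).PosSemidef
  tp : ∀ ρ : Matrix α α ℂ, (map ρ).trace = ρ.trace

/-- The classical-quantum state `Σ_x p(x) |x⟩⟨x| ⊗ σ^x`. -/
def cqState {ι γ : Type*} [DecidableEq ι] (p : ι → ℝ) (σ : ι → Matrix γ γ ℂ) :
    Matrix (ι × γ) (ι × γ) ℂ :=
  Matrix.of fun a b => if a.1 = b.1 then (p a.1 : ℂ) * σ a.1 a.2 b.2 else 0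

/-- A probability distribution on a finite alphabet. -/
def IsProbDist {ι : Type*} [Fintype ι] (p : ι → ℝ) : Prop :=
  (∀ x, 0 ≤ p x) ∧ ∑ x, p x = 1

section Assisted

variable {EA EB A B : Type*} [Fintype EA] [DecidableEq EA] [Fintype EB] [DecidableEq EB]
  [Fintype A] [DecidableEq A] [Fintype B] [DecidableEq B]

/-- The output state `(N ∘ E ⊗ id_{E_B})(ρ_{E_AE_B})` on `B ⊗ E_B`. -/
def assistedOut (N : QChannel A B) (E : QChannel EA A)
    (ρ : Matrix (EA × EB) (EA × EB) ℂ) : Matrix (B × EB) (B × EB) ℂ :=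
  rTensor EB (N.map ∘ₗ E.map) ρ

/-- The classical-quantum state
`ω_{XBE_B} = Σ_x p(x) |x⟩⟨x|_X ⊗ (N∘E^x ⊗ id_{E_B})(ρ_{E_AE_B})`. -/
def assistedCQ (N : QChannel A B) (ρ : Matrix (EA × EB) (EA × EB) ℂ)
    {n : ℕ} (p : Fin n → ℝ) (E : Fin n → QChannel EA A) :
    Matrix (Fin n × (B × EB)) (Fin n × (B × EB)) ℂ :=
  cqState p fun x => assistedOut N (E x) ρ

/-- Marginal of a state on `X ⊗ (B ⊗ E_B)` obtained by tracing out `B`. -/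
def margXE {X : Type*} (ω : Matrix (X × (B × EB)) (X × (B × EB)) ℂ) :
    Matrix (X × EB) (X × EB) ℂ :=
  Matrix.of fun p q => ∑ b, ω (p.1, (b, p.2)) (q.1, (b, q.2))

/-- `I(XE_B:B)` of a state on `X ⊗ (B ⊗ E_B)` (entropy form). -/
def infoXE_B {X : Type*} [Fintype X] [DecidableEq X]
    (ω : Matrix (X × (B × EB)) (X × (B × EB)) ℂ) : ℝ :=
  entropy (margXE ω) + entropy (ptrR (ptrL ω)) - entropy ω

/-- Regrouping `(X × E_B) × B ≃ X × (B × E_B)`. -/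
def regroupEquiv (X B EB : Type*) : (X × EB) × B ≃ X × (B × EB) :=
  (Equiv.prodAssoc X EB B).trans (Equiv.prodCongr (Equiv.refl X) (Equiv.prodComm EB B))

/-- `I(XE_B:B)` of a state on `X ⊗ (B ⊗ E_B)` (relative-entropy form). -/
def infoXE_B_D {X : Type*} [Fintype X] [DecidableEq X]
    (ω : Matrix (X × (B × EB)) (X × (B × EB)) ℂ) : ℝ :=
  mutualInfoD (ω.submatrix (regroupEquiv X B EB) (regroupEquiv X B EB))

/-- The `ρ`-assisted Holevo information `χ_ρ(N)` (entropy form of `I`). -/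
def assistedHolevoS (N : QChannel A B) (ρ : Matrix (EA × EB) (EA × EB) ℂ) : ℝ :=
  sSup { r | ∃ (n : ℕ) (p : Fin n → ℝ) (E : Fin n → QChannel EA A),
    IsProbDist p ∧ r = mutualInfoS (assistedCQ N ρ p E) }

/-- The `ρ`-assisted Holevo information `χ_ρ(N)` (relative-entropy form of `I`). -/
def assistedHolevoD (N : QChannel A B) (ρ : Matrix (EA × EB) (EA × EB) ℂ) : ℝ :=
  sSup { r | ∃ (n : ℕ) (p : Fin n → ℝ) (E : Fin n → QChannel EA A),
    IsProbDist p ∧ r = mutualInfoD (assistedCQ N ρ p E) }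

/-- The `ρ`-assisted mutual information `I_ρ(N)` (entropy form of `I`). -/
def assistedMutualS (N : QChannel A B) (ρ : Matrix (EA × EB) (EA × EB) ℂ) : ℝ :=
  sSup { r | ∃ (n : ℕ) (p : Fin n → ℝ) (E : Fin n → QChannel EA A),
    IsProbDist p ∧ r = infoXE_B (assistedCQ N ρ p E) }

/-- The `ρ`-assisted mutual information `I_ρ(N)` (relative-entropy form of `I`). -/
def assistedMutualD (N : QChannel A B) (ρ : Matrix (EA × EB) (EA × EB) ℂ) : ℝ :=
  sSup { r | ∃ (n : ℕ) (p : Fin n → ℝ) (E : Fin n → QChannel EA A),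
    IsProbDist p ∧ r = infoXE_B_D (assistedCQ N ρ p E) }

/-- The (unassisted) Holevo information `χ(N)` (entropy form of `I`). -/
def holevoS (N : QChannel A B) : ℝ :=
  sSup { r | ∃ (n : ℕ) (p : Fin n → ℝ) (σ : Fin n → Matrix A A ℂ),
    IsProbDist p ∧ (∀ x, IsState (σ x)) ∧
    r = mutualInfoS (cqState p fun x => N.map (σ x)) }

/-- The (unassisted) Holevo information `χ(N)` (relative-entropy form of `I`). -/
def holevoD (N : QChannel A B) : ℝ :=
  sSup { r | ∃ (n : ℕ) (p : Fin n → ℝ) (σ : Fin n → Matrix A A ℂ),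
    IsProbDist p ∧ (∀ x, IsState (σ x)) ∧
    r = mutualInfoD (cqState p fun x => N.map (σ x)) }

end Assisted

section ChannelMI

variable {A B : Type*} [Fintype A] [DecidableEq A] [Fintype B] [DecidableEq B]

/-- `φ_{AA'}` is a purification of `ρ_A`: a pure state whose marginal on the
first factor is `ρ_A`. -/
def IsPurification {A' : Type*} [Fintype A']
    (φ : Matrix (A × A') (A × A') ℂ) (ρ : Matrix A A ℂ) : Prop :=
  IsState φ ∧ IsPure φ ∧ ptrR φ = ρ

/-- The mutual information of the channel `N`,
`I(N) = max_{ρ_A} I(A':B)_{(N ⊗ id)(φ_{AA'})}` (purifying system `A' ≅ A`). -/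
def channelMI (N : QChannel A B) : ℝ :=
  sSup { r | ∃ (ρA : Matrix A A ℂ) (φ : Matrix (A × A) (A × A) ℂ),
    IsState ρA ∧ IsPurification φ ρA ∧ r = mutualInfoS (rTensor A N.map φ) }

end ChannelMI

section Coding

variable {EA EB A B : Type*} [Fintype EA] [DecidableEq EA] [Fintype EB] [DecidableEq EB]
  [Fintype A] [DecidableEq A] [Fintype B] [DecidableEq B]

/-- Product of `n` states on `B ⊗ E_B`, arranged on `B^n ⊗ E_B^n`. -/
def prodState {n : ℕ} (τ : Fin n → Matrix (B × EB) (B × EB) ℂ) :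
    Matrix ((Fin n → B) × (Fin n → EB)) ((Fin n → B) × (Fin n → EB)) ℂ :=
  Matrix.of fun p q => ∏ i, τ i (p.1 i, p.2 i) (q.1 i, q.2 i)

/-- Product of `n` states on `B ⊗ E_B`, with the `B^n` systems permuted by `π`. -/
def permProdState {n : ℕ} (π : Equiv.Perm (Fin n))
    (τ : Fin n → Matrix (B × EB) (B × EB) ℂ) :
    Matrix ((Fin n → B) × (Fin n → EB)) ((Fin n → B) × (Fin n → EB)) ℂ :=
  Matrix.of fun p q => ∏ i, τ i (p.1 (π i), p.2 i) (q.1 (π i), q.2 i)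

/-- Average decoding error probability of a code with message-dependent output
states `ω^m` and decoding POVM `{Λ_m}`. -/
def avgErr {n M : ℕ}
    (ω : Fin M → Matrix ((Fin n → B) × (Fin n → EB)) ((Fin n → B) × (Fin n → EB)) ℂ)
    (Λ : Fin M → Matrix ((Fin n → B) × (Fin n → EB)) ((Fin n → B) × (Fin n → EB)) ℂ) : ℝ :=
  (1 / (M : ℝ)) * ∑ m, ((1 - Λ m) * ω m).trace.re

/-- Existence of a blocklength-`n`, `M`-message, error-`≤ ε` code with product
encodings for the state-channel pair `(ρ, N)`. -/
def ProdCode (N : QChannel A B) (ρ : Matrix (EA × EB) (EA × EB) ℂ)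
    (n M : ℕ) (ε : ℝ) : Prop :=
  ∃ (Enc : Fin M → Fin n → QChannel EA A)
    (Λ : Fin M → Matrix ((Fin n → B) × (Fin n → EB)) ((Fin n → B) × (Fin n → EB)) ℂ),
    (∀ m, (Λ m).PosSemidef) ∧ (∑ m, Λ m) = 1 ∧
    avgErr (fun m => prodState fun i => assistedOut N (Enc m i) ρ) Λ ≤ ε

/-- Existence of a blocklength-`n`, `M`-message, error-`≤ ε` code with
semi-global encodings (local encodings followed by a global permutation). -/
def SemiGlobalCode (N : QChannel A B) (ρ : Matrix (EA × EB) (EA × EB) ℂ)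
    (n M : ℕ) (ε : ℝ) : Prop :=
  ∃ (Enc : Fin M → Fin n → QChannel EA A) (perm : Fin M → Equiv.Perm (Fin n))
    (Λ : Fin M → Matrix ((Fin n → B) × (Fin n → EB)) ((Fin n → B) × (Fin n → EB)) ℂ),
    (∀ m, (Λ m).PosSemidef) ∧ (∑ m, Λ m) = 1 ∧
    avgErr (fun m => permProdState (perm m) fun i => assistedOut N (Enc m i) ρ) Λ ≤ ε

/-- `R` is an `ε`-achievable rate with product encodings. -/
def ProdAchievable (N : QChannel A B) (ρ : Matrix (EA × EB) (EA × EB) ℂ)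
    (ε R : ℝ) : Prop :=
  ∀ δ : ℝ, 0 < δ → ∃ n₀ : ℕ, ∀ n ≥ n₀, ∃ M : ℕ,
    R - δ ≤ Real.logb 2 M / n ∧ ProdCode N ρ n M ε

/-- `R` is an `ε`-achievable rate with semi-global encodings. -/
def SemiGlobalAchievable (N : QChannel A B) (ρ : Matrix (EA × EB) (EA × EB) ℂ)
    (ε R : ℝ) : Prop :=
  ∀ δ : ℝ, 0 < δ → ∃ n₀ : ℕ, ∀ n ≥ n₀, ∃ M : ℕ,
    R - δ ≤ Real.logb 2 M / n ∧ SemiGlobalCode N ρ n M ε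

/-- The `ρ`-assisted `ε`-classical capacity with product encodings. -/
def prodCapacity (N : QChannel A B) (ρ : Matrix (EA × EB) (EA × EB) ℂ) (ε : ℝ) : ℝ :=
  sSup { R | ProdAchievable N ρ ε R }

/-- The `ρ`-assisted `ε`-classical capacity with semi-global encodings. -/
def semiGlobalCapacity (N : QChannel A B) (ρ : Matrix (EA × EB) (EA × EB) ℂ) (ε : ℝ) : ℝ :=
  sSup { R | SemiGlobalAchievable N ρ ε R }

end Coding

/-- The phase (Weyl) unitary `Z^u = Σ_z e^{2πiuz/d}|z⟩⟨z|` on `ℂ^d`. -/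
def Zmat (d : ℕ) (u : Fin d) : Matrix (Fin d) (Fin d) ℂ :=
  Matrix.diagonal fun z => Complex.exp (2 * Real.pi * Complex.I * u.1 * z.1 / d)

/-- Conjugation of a bipartite state by the phase unitary `Z^u ⊗ 1`. -/
def phaseConj {EB : Type*} [Fintype EB] [DecidableEq EB] (d : ℕ) (u : Fin d)
    (φ : Matrix (Fin d × EB) (Fin d × EB) ℂ) : Matrix (Fin d × EB) (Fin d × EB) ℂ :=
  (Zmat d u ⊗ₖ (1 : Matrix EB EB ℂ)) * φ * (Zmat d u ⊗ₖ (1 : Matrix EB EB ℂ))ᴴ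

/-- The (unnormalized) conditional operator `⟨z|φ|z⟩` on `E_B`. -/
def condState {EB : Type*} {d : ℕ} (φ : Matrix (Fin d × EB) (Fin d × EB) ℂ)
    (z : Fin d) : Matrix EB EB ℂ :=
  Matrix.of fun e e' => φ (z, e) (z, e')

/-- Shannon entropy (base 2) of a probability vector. -/
def shannonEnt {ι : Type*} [Fintype ι] (p : ι → ℝ) : ℝ :=
  -∑ i, p i * Real.logb 2 (p i)

/-- Binary entropy (base 2). -/
def binEnt (p : ℝ) : ℝ :=
  -(p * Real.logb 2 p) - (1 - p) * Real.logb 2 (1 - p)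

/-- Kullback-Leibler divergence (base 2) between probability vectors. -/
def klDiv {ι : Type*} [Fintype ι] (p q : ι → ℝ) : ℝ :=
  ∑ i, p i * Real.logb 2 (p i / q i)

section Discord

variable {α β : Type*} [Fintype α] [DecidableEq α] [Fintype β] [DecidableEq β]

/-- The (unnormalized) operator `⟨v|ρ|v⟩` on `α`, sandwiching on the second factor. -/
def sandwichR (ρ : Matrix (α × β) (α × β) ℂ) (v : β → ℂ) : Matrix α α ℂ :=
  Matrix.of fun a a' => ∑ b, ∑ b', star (v b) * ρ (a, b) (a', b') * v b'

/-- The relative entropy of discord `D_R(ρ_{AB})`. -/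
def relEntDiscord (ρ : Matrix (α × β) (α × β) ℂ) : ℝ :=
  sInf { r | ∃ V ∈ Matrix.unitaryGroup β ℂ, r = relEnt ρ
    (∑ y : β, sandwichR ρ (fun b => V b y) ⊗ₖ
      Matrix.vecMulVec (fun b => V b y) (star fun b => V b y)) }

/-- The discord of formation `D_F(ρ_{AB})`. -/
def discordOfFormation (ρ : Matrix (α × β) (α × β) ℂ) : ℝ :=
  sInf { r | ∃ (n : ℕ) (p : Fin n → ℝ) (τ : Fin n → Matrix (α × β) (α × β) ℂ),
    IsProbDist p ∧ (∀ x, IsState (τ x)) ∧ (ρ = ∑ x, (p x : ℂ) • τ x) ∧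
    r = ∑ x, p x * relEntDiscord (τ x) }

end Discord

/-- The matrix `U diag(d) U*` with real diagonal `d`. -/
def diagConj {ι : Type*} [Fintype ι] [DecidableEq ι] (U : Matrix ι ι ℂ) (d : ι → ℝ) :
    Matrix ι ι ℂ :=
  U * Matrix.diagonal (fun i => (d i : ℂ)) * star U

section DiagConj

variable {ι : Type*} [Fintype ι] [DecidableEq ι]

lemma diagConj_apply (U : Matrix ι ι ℂ) (d : ι → ℝ) (i j : ι) :
    diagConj U d i j = ∑ k, U i k * d k * star (U j k) := by
  rw [diagConj, Matrix.mul_apply]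
  simp only [Matrix.mul_diagonal, Matrix.star_apply]

lemma diagConj_isHermitian (U : Matrix ι ι ℂ) (d : ι → ℝ) : (diagConj U d).IsHermitian := by
  ext i j
  simp only [Matrix.conjTranspose_apply, diagConj_apply, star_sum, star_mul', star_star]
  refine Finset.sum_congr rfl fun k _ => ?_
  simp only [RCLike.star_def, Complex.conj_ofReal]
  ring

lemma trace_diagConj_mul (U V : Matrix ι ι ℂ) (d e : ι → ℝ) :
    (diagConj U d * diagConj V e).trace =
      ((∑ a, ∑ c, d a * e c * Complex.normSq ((star V * U) c a) : ℝ) : ℂ) := by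
  have h : (diagConj U d * diagConj V e).trace =
      (diagonal (fun i => (d i : ℂ)) * (star (star V * U) *
        (diagonal (fun i => (e i : ℂ)) * (star V * U)))).trace := by
    rw [diagConj, Matrix.mul_assoc U, Matrix.mul_assoc U, Matrix.trace_mul_comm]
    simp only [diagConj, Matrix.mul_assoc, star_mul, star_star]
  rw [h, Matrix.trace]
  push_cast
  refine Finset.sum_congr rfl fun a _ => ?_
  rw [Matrix.diag_apply, Matrix.diagonal_mul, Matrix.mul_apply, Finset.mul_sum]
  refine Finset.sum_congr rfl fun c _ => ?_
  rw [Matrix.diagonal_mul, Matrix.star_apply, Complex.normSq_eq_conj_mul_self, RCLike.star_def]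
  ring

lemma sum_normSq_col {G : Matrix ι ι ℂ} (hG : G ∈ Matrix.unitaryGroup ι ℂ) (a : ι) :
    ∑ c, Complex.normSq (G c a) = 1 := by
  have h := congrFun (congrFun (Matrix.mem_unitaryGroup_iff'.1 hG) a) a
  rw [Matrix.mul_apply, Matrix.one_apply_eq] at h
  simp only [Matrix.star_apply, RCLike.star_def, ← Complex.normSq_eq_conj_mul_self] at h
  exact_mod_cast h

lemma sum_normSq_row {G : Matrix ι ι ℂ} (hG : G ∈ Matrix.unitaryGroup ι ℂ) (c : ι) :
    ∑ a, Complex.normSq (G c a) = 1 := by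
  have h := congrFun (congrFun (Matrix.mem_unitaryGroup_iff.1 hG) c) c
  rw [Matrix.mul_apply, Matrix.one_apply_eq] at h
  simp only [Matrix.star_apply, RCLike.star_def, Complex.mul_conj] at h
  exact_mod_cast h

lemma star_mul_mem_unitaryGroup {U V : Matrix ι ι ℂ} (hU : U ∈ Matrix.unitaryGroup ι ℂ)
    (hV : V ∈ Matrix.unitaryGroup ι ℂ) : star V * U ∈ Matrix.unitaryGroup ι ℂ :=
  mul_mem (Unitary.star_mem hV) hU

lemma trace_diagConj {U : Matrix ι ι ℂ} (hU : U ∈ Matrix.unitaryGroup ι ℂ) (d : ι → ℝ) :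
    (diagConj U d).trace = ((∑ i, d i : ℝ) : ℂ) := by
  rw [diagConj, Matrix.trace_mul_comm, ← Matrix.mul_assoc, Matrix.mem_unitaryGroup_iff'.1 hU,
    Matrix.one_mul, Matrix.trace_diagonal]
  push_cast; rfl

lemma diagConj_mul_diagConj {U : Matrix ι ι ℂ} (hU : U ∈ Matrix.unitaryGroup ι ℂ)
    (d e : ι → ℝ) : diagConj U d * diagConj U e = diagConj U (fun i => d i * e i) := by
  calc diagConj U d * diagConj U e = U * diagonal (fun i => (d i : ℂ)) * (star U * U) *
        diagonal (fun i => (e i : ℂ)) * star U := by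
          simp only [diagConj, Matrix.mul_assoc]
    _ = _ := by
      rw [Matrix.mem_unitaryGroup_iff'.1 hU]
      simp only [diagConj, Matrix.mul_assoc, Matrix.one_mul]
      rw [← Matrix.mul_assoc (diagonal _) (diagonal _), Matrix.diagonal_mul_diagonal]
      push_cast; rfl

lemma exists_diagConj {X : Matrix ι ι ℂ} (hX : X.IsHermitian) :
    ∃ U ∈ Matrix.unitaryGroup ι ℂ, X = diagConj U hX.eigenvalues ∧
      matLog X = diagConj U (fun i => Real.logb 2 (hX.eigenvalues i)) := by
  refine ⟨_, hX.eigenvectorUnitary.2, ?_, ?_⟩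
  · conv_lhs => rw [hX.spectral_theorem]
    rfl
  · rw [matLog, dif_pos hX]; rfl

lemma entropy_eq_sum_eigenvalues {X : Matrix ι ι ℂ} (hX : X.IsHermitian) :
    entropy X = -∑ i, hX.eigenvalues i * Real.logb 2 (hX.eigenvalues i) := by
  obtain ⟨U, hU, h1, h2⟩ := exists_diagConj hX
  have h3 : X * matLog X =
      diagConj U (fun i => hX.eigenvalues i * Real.logb 2 (hX.eigenvalues i)) := by
    rw [h2]
    exact (congrArg (· * _) h1).trans (diagConj_mul_diagConj hU _ _)
  rw [entropy, h3, trace_diagConj hU, Complex.ofReal_re]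

lemma entropy_diagConj {U : Matrix ι ι ℂ} (hU : U ∈ Matrix.unitaryGroup ι ℂ) (d : ι → ℝ) :
    entropy (diagConj U d) = -∑ i, d i * Real.logb 2 (d i) := by
  rw [entropy_eq_sum_eigenvalues (diagConj_isHermitian U d)]
  have hroots := (diagConj_isHermitian U d).roots_charpoly_eq_eigenvalues
  have hch : (diagConj U d).charpoly = (Matrix.diagonal (fun i => (d i : ℂ))).charpoly := by
    rw [diagConj, Matrix.charpoly_mul_comm, ← Matrix.mul_assoc,
      Matrix.mem_unitaryGroup_iff'.1 hU, Matrix.one_mul]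
  rw [hch, Matrix.charpoly_diagonal, Polynomial.roots_prod _ _
    (Finset.prod_ne_zero_iff.2 fun i _ => Polynomial.X_sub_C_ne_zero _)] at hroots
  simp only [Polynomial.roots_X_sub_C, Multiset.bind_singleton] at hroots
  have := congrArg (fun s => (s.map (fun z : ℂ => z.re * Real.logb 2 z.re)).sum) hroots
  simp only [Multiset.map_map, Function.comp_def, Complex.ofReal_re] at this
  rw [neg_inj]
  exact this.symm

lemma isState_eigenvalues {X : Matrix ι ι ℂ} (hX : IsState X) :
    (∀ i, 0 ≤ hX.1.isHermitian.eigenvalues i) ∧ ∑ i, hX.1.isHermitian.eigenvalues i = 1 := by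
  refine ⟨hX.1.eigenvalues_nonneg, ?_⟩
  have h := hX.2.symm.trans hX.1.isHermitian.trace_eq_sum_eigenvalues
  have := congrArg Complex.re h
  simpa using this.symm

/-- Chi-square type lower bound on the entropy of a state `X` near `Y`. -/
lemma entropy_ge_of_eigenvalues_ge {X Y : Matrix ι ι ℂ} (hX : IsState X) (hY : IsState Y)
    {c : ℝ} (hc : 0 < c) (hcY : ∀ i, c ≤ hY.1.isHermitian.eigenvalues i) :
    -(X * matLog Y).trace.re - ((X - Y) * (X - Y)).trace.re / (c * Real.log 2) ≤ entropy X := by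
  obtain ⟨hl0, hl1⟩ := isState_eigenvalues hX
  obtain ⟨hm0, hm1⟩ := isState_eigenvalues hY
  obtain ⟨U, hU, hX1, hX2⟩ := exists_diagConj hX.1.isHermitian
  obtain ⟨V, hV, hY1, hY2⟩ := exists_diagConj hY.1.isHermitian
  rw [entropy_eq_sum_eigenvalues hX.1.isHermitian]
  set l := hX.1.isHermitian.eigenvalues
  set m := hY.1.isHermitian.eigenvalues
  have hG := star_mul_mem_unitaryGroup hU hV
  set q : ι → ι → ℝ := fun a b => Complex.normSq ((star V * U) b a) with hq
  have hq0 : ∀ a b, 0 ≤ q a b := fun a b => Complex.normSq_nonneg _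
  have hqa : ∀ a, ∑ b, q a b = 1 := fun a => sum_normSq_col hG a
  have hqb : ∀ b, ∑ a, q a b = 1 := fun b => sum_normSq_row hG b
  have e1 : (X * matLog Y).trace.re = ∑ a, ∑ b, l a * Real.logb 2 (m b) * q a b := by
    rw [hY2, hX1, trace_diagConj_mul, Complex.ofReal_re]
  have eXX : (X * X).trace.re = ∑ a, ∑ b, l a ^ 2 * q a b := by
    have : X * X = diagConj U (fun i => l i * l i) := by
      rw [← diagConj_mul_diagConj hU, ← hX1]
    rw [this, trace_diagConj hU, Complex.ofReal_re]
    simp only [← Finset.mul_sum, hqa, mul_one, sq]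
  have eYY : (Y * Y).trace.re = ∑ a, ∑ b, m b ^ 2 * q a b := by
    have : Y * Y = diagConj V (fun i => m i * m i) := by
      rw [← diagConj_mul_diagConj hV, ← hY1]
    rw [this, trace_diagConj hV, Complex.ofReal_re, Finset.sum_comm]
    simp only [← Finset.mul_sum, hqb, mul_one, sq]
  have eXY : (X * Y).trace.re = ∑ a, ∑ b, l a * m b * q a b := by
    conv_lhs => rw [hX1, hY1]
    rw [trace_diagConj_mul, Complex.ofReal_re]
  have e2 : ((X - Y) * (X - Y)).trace.re = ∑ a, ∑ b, (l a - m b) ^ 2 * q a b := by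
    have : ((X - Y) * (X - Y)).trace = (X * X).trace - 2 * (X * Y).trace + (Y * Y).trace := by
      rw [sub_mul, mul_sub, mul_sub, Matrix.trace_sub, Matrix.trace_sub, Matrix.trace_sub,
        Matrix.trace_mul_comm Y X]
      ring
    rw [this, Complex.add_re, Complex.sub_re, eXX, eYY]
    rw [show ((2 : ℂ) * (X * Y).trace).re = 2 * (X * Y).trace.re by simp, eXY]
    simp only [Finset.mul_sum, ← Finset.sum_sub_distrib, ← Finset.sum_add_distrib]
    refine Finset.sum_congr rfl fun a _ => Finset.sum_congr rfl fun b _ => ?_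
    ring
  have e3 : ∑ i, l i * Real.logb 2 (l i) = ∑ a, ∑ b, l a * Real.logb 2 (l a) * q a b := by
    simp only [← Finset.mul_sum, hqa, mul_one]
  have e4 : ∑ a, ∑ b, (l a - m b) * q a b = 0 := by
    have h1 : ∑ a, ∑ b, l a * q a b = 1 := by
      simp only [← Finset.mul_sum, hqa, mul_one, hl1]
    have h2 : ∑ a, ∑ b, m b * q a b = 1 := by
      rw [Finset.sum_comm]; simp only [← Finset.mul_sum, hqb, mul_one, hm1]
    simp only [sub_mul, Finset.sum_sub_distrib, h1, h2, sub_self]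
  have hlog2 : 0 < Real.log 2 := Real.log_pos one_lt_two
  have key : ∀ a b, l a * Real.logb 2 (l a) * q a b ≤ l a * Real.logb 2 (m b) * q a b +
      ((l a - m b) ^ 2 * q a b / (c * Real.log 2) + (l a - m b) * q a b / Real.log 2) := by
    intro a b
    have hmb : 0 < m b := hc.trans_le (hcY b)
    have h1 : l a * (Real.log (l a) - Real.log (m b)) ≤ (l a - m b) ^ 2 / c + (l a - m b) := by
      have h2 : l a * (Real.log (l a) - Real.log (m b)) ≤ l a * (l a / m b - 1) := by
        rcases (hl0 a).eq_or_lt with h | h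
        · rw [← h]; simp
        · refine mul_le_mul_of_nonneg_left ?_ h.le
          rw [← Real.log_div h.ne' hmb.ne']
          exact Real.log_le_sub_one_of_pos (div_pos h hmb)
      have h3 : l a * (l a / m b - 1) = (l a - m b) ^ 2 / m b + (l a - m b) := by
        field_simp; ring
      have h4 : (l a - m b) ^ 2 / m b ≤ (l a - m b) ^ 2 / c :=
        div_le_div_of_nonneg_left (sq_nonneg _) hc (hcY b)
      linarith
    have h5 := mul_le_mul_of_nonneg_right (div_le_div_of_nonneg_right h1 hlog2.le) (hq0 a b)
    simp only [Real.logb]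
    have h6 : ((l a - m b) ^ 2 / c + (l a - m b)) / Real.log 2 * q a b =
      (l a - m b) ^ 2 * q a b / (c * Real.log 2) + (l a - m b) * q a b / Real.log 2 := by
      field_simp
    have h7 : l a * (Real.log (l a) - Real.log (m b)) / Real.log 2 * q a b =
      l a * (Real.log (l a) / Real.log 2) * q a b -
        l a * (Real.log (m b) / Real.log 2) * q a b := by
      field_simp
    linarith
  have := Finset.sum_le_sum fun a (_ : a ∈ Finset.univ) =>
    Finset.sum_le_sum fun b (_ : b ∈ Finset.univ) => key a b
  simp only [Finset.sum_add_distrib, ← Finset.sum_div, e4, zero_div, add_zero] at this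
  rw [e1, e2, e3]
  linarith

end DiagConj

section Depolarize

variable {ι : Type*} [Fintype ι] [DecidableEq ι]

lemma diagConj_smul_add_smul_one {U : Matrix ι ι ℂ} (hU : U ∈ Matrix.unitaryGroup ι ℂ)
    (d : ι → ℝ) (x y : ℝ) :
    (x : ℂ) • diagConj U d + (y : ℂ) • (1 : Matrix ι ι ℂ) = diagConj U (fun i => x * d i + y) := by
  have h1 : diagonal (fun i => ((x * d i + y : ℝ) : ℂ)) =
      (x : ℂ) • diagonal (fun i => (d i : ℂ)) + (y : ℂ) • (1 : Matrix ι ι ℂ) := by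
    ext i j
    by_cases h : i = j
    · subst h; simp
    · simp [h]
  rw [diagConj, diagConj, h1, Matrix.mul_add, Matrix.add_mul, Matrix.mul_smul, Matrix.smul_mul,
    Matrix.mul_smul, Matrix.smul_mul, Matrix.mul_one, Matrix.mem_unitaryGroup_iff.1 hU]

/-- Mixing of a matrix with the maximally mixed state. -/
def depol (η : ℝ) (X : Matrix ι ι ℂ) : Matrix ι ι ℂ :=
  ((1 - η : ℝ) : ℂ) • X + ((η / Fintype.card ι : ℝ) : ℂ) • (1 : Matrix ι ι ℂ)

lemma depol_isState [Nonempty ι] {η : ℝ} (h0 : 0 ≤ η) (h1 : η ≤ 1) {X : Matrix ι ι ℂ}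
    (hX : IsState X) : IsState (depol η X) := by
  refine ⟨(hX.1.smul ?_).add (Matrix.PosSemidef.one.smul ?_), ?_⟩
  · exact_mod_cast sub_nonneg.2 h1
  · exact_mod_cast div_nonneg h0 (Nat.cast_nonneg _)
  · rw [depol, Matrix.trace_add, Matrix.trace_smul, Matrix.trace_smul, hX.2, Matrix.trace_one]
    have : (Fintype.card ι : ℂ) ≠ 0 := by exact_mod_cast Fintype.card_ne_zero
    push_cast
    simp only [smul_eq_mul]
    field_simp
    ring

lemma eigenvalues_ge_of_sub_posSemidef {X : Matrix ι ι ℂ} (hX : X.IsHermitian) {c : ℝ}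
    (h : (X - (c : ℂ) • (1 : Matrix ι ι ℂ)).PosSemidef) (i : ι) : c ≤ hX.eigenvalues i := by
  obtain ⟨U, hU, h1, -⟩ := exists_diagConj hX
  set l := hX.eigenvalues
  have h2 : X - (c : ℂ) • (1 : Matrix ι ι ℂ) = diagConj U (fun i => 1 * l i + (-c)) := by
    rw [← diagConj_smul_add_smul_one hU, ← h1]
    simp [sub_eq_add_neg]
  have h3 := h.conjTranspose_mul_mul_same U
  rw [h2, diagConj, ← Matrix.star_eq_conjTranspose] at h3
  have h4 : star U * (U * diagonal (fun i => ((1 * l i + -c : ℝ) : ℂ)) * star U) * U =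
      diagonal (fun i => ((1 * l i + -c : ℝ) : ℂ)) := by
    calc _ = (star U * U) * diagonal (fun i => ((1 * l i + -c : ℝ) : ℂ)) * (star U * U) := by
          simp only [Matrix.mul_assoc]
      _ = _ := by rw [Matrix.mem_unitaryGroup_iff'.1 hU, Matrix.one_mul, Matrix.mul_one]
  rw [h4] at h3
  have h5 := h3.diag_nonneg (i := i)
  rw [Matrix.diagonal_apply_eq] at h5
  have : 0 ≤ 1 * l i + -c := by exact_mod_cast h5
  linarith

lemma eigenvalues_depol_ge [Nonempty ι] {η : ℝ} (h0 : 0 ≤ η) (h1 : η ≤ 1) {X : Matrix ι ι ℂ}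
    (hX : IsState X) (i : ι) :
    η / Fintype.card ι ≤ (depol_isState h0 h1 hX).1.isHermitian.eigenvalues i := by
  refine eigenvalues_ge_of_sub_posSemidef _ ?_ i
  rw [depol, add_sub_cancel_right]
  refine hX.1.smul ?_
  exact_mod_cast sub_nonneg.2 h1

lemma eigenvalues_le_one {X : Matrix ι ι ℂ} (hX : IsState X) (i : ι) :
    hX.1.isHermitian.eigenvalues i ≤ 1 := by
  obtain ⟨h0, h1⟩ := isState_eigenvalues hX
  rw [← h1]
  exact Finset.single_le_sum (fun j _ => h0 j) (Finset.mem_univ i)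

lemma exists_depol_entropy_le [Nonempty ι] {κ : ℝ} (hκ : 0 < κ) :
    ∃ δ > 0, ∀ η : ℝ, 0 ≤ η → η < δ → η ≤ 1 → ∀ X : Matrix ι ι ℂ, IsState X →
      entropy (depol η X) ≤ entropy X + κ := by
  have hcard : (0 : ℝ) < Fintype.card ι := by exact_mod_cast Fintype.card_pos
  have hcont : Continuous fun x : ℝ => x * Real.logb 2 x := by
    have := Real.continuous_mul_log.div_const (Real.log 2)
    refine this.congr fun x => ?_
    rw [Real.logb, mul_div_assoc]
  have huc := (isCompact_Icc (a := (0 : ℝ)) (b := 1)).uniformContinuousOn_of_continuous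
    hcont.continuousOn
  rw [Metric.uniformContinuousOn_iff] at huc
  obtain ⟨δ, hδ, h⟩ := huc (κ / Fintype.card ι) (div_pos hκ hcard)
  refine ⟨δ, hδ, fun η h0 hηδ h1 X hX => ?_⟩
  obtain ⟨U, hU, hX1, -⟩ := exists_diagConj hX.1.isHermitian
  obtain ⟨hl0, -⟩ := isState_eigenvalues hX
  have hl1 := eigenvalues_le_one hX
  rw [entropy_eq_sum_eigenvalues hX.1.isHermitian]
  set l := hX.1.isHermitian.eigenvalues
  have h2 : depol η X = diagConj U (fun i => (1 - η) * l i + η / Fintype.card ι) := by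
    rw [depol, ← diagConj_smul_add_smul_one hU, ← hX1]
  rw [h2, entropy_diagConj hU]
  have hc1 : (1 : ℝ) ≤ Fintype.card ι := by exact_mod_cast Fintype.card_pos
  have hη1 : η / Fintype.card ι ≤ η := div_le_self h0 hc1
  have hη0 : 0 ≤ η / Fintype.card ι := div_nonneg h0 hcard.le
  have key : ∀ i ∈ (Finset.univ : Finset ι), l i * Real.logb 2 (l i) - κ / Fintype.card ι ≤
      ((1 - η) * l i + η / Fintype.card ι) *
        Real.logb 2 ((1 - η) * l i + η / Fintype.card ι) := by
    intro i _
    have a1 : l i ∈ Set.Icc (0 : ℝ) 1 := ⟨hl0 i, hl1 i⟩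
    have a2 : (1 - η) * l i + η / Fintype.card ι ∈ Set.Icc (0 : ℝ) 1 := by
      constructor
      · have := mul_nonneg (sub_nonneg.2 h1) (hl0 i); linarith
      · have := mul_le_mul_of_nonneg_left (hl1 i) (sub_nonneg.2 h1); linarith
    have a3 : dist (l i) ((1 - η) * l i + η / Fintype.card ι) < δ := by
      rw [Real.dist_eq, abs_lt]
      have := mul_nonneg h0 (hl0 i)
      have := mul_le_mul_of_nonneg_left (hl1 i) h0
      constructor <;> nlinarith
    have := h _ a1 _ a2 a3
    rw [Real.dist_eq, abs_lt] at this
    linarith [this.2]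
  have := Finset.sum_le_sum key
  rw [Finset.sum_sub_distrib, Finset.sum_const, Finset.card_univ, nsmul_eq_mul,
    mul_div_cancel₀ _ hcard.ne'] at this
  linarith

lemma trace_sub_sq_le {X Y : Matrix ι ι ℂ} (hX : IsState X) (hY : IsState Y) :
    ((X - Y) * (X - Y)).trace.re ≤ 2 := by
  have hsq : ∀ {Z : Matrix ι ι ℂ}, IsState Z → (Z * Z).trace.re ≤ 1 := by
    intro Z hZ
    obtain ⟨U, hU, h1, -⟩ := exists_diagConj hZ.1.isHermitian
    obtain ⟨hl0, hl⟩ := isState_eigenvalues hZ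
    have hl1 := eigenvalues_le_one hZ
    set l := hZ.1.isHermitian.eigenvalues
    have : Z * Z = diagConj U (fun i => l i * l i) := by
      rw [← diagConj_mul_diagConj hU, ← h1]
    rw [this, trace_diagConj hU, Complex.ofReal_re, ← hl]
    exact Finset.sum_le_sum fun i _ => mul_le_of_le_one_left (hl0 i) (hl1 i)
  have hXY : 0 ≤ (X * Y).trace.re := by
    obtain ⟨U, hU, h1, -⟩ := exists_diagConj hX.1.isHermitian
    obtain ⟨V, hV, h2, -⟩ := exists_diagConj hY.1.isHermitian
    obtain ⟨hl0, -⟩ := isState_eigenvalues hX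
    obtain ⟨hm0, -⟩ := isState_eigenvalues hY
    have : X * Y = diagConj U hX.1.isHermitian.eigenvalues *
        diagConj V hY.1.isHermitian.eigenvalues := congrArg₂ (· * ·) h1 h2
    rw [this, trace_diagConj_mul, Complex.ofReal_re]
    exact Finset.sum_nonneg fun a _ => Finset.sum_nonneg fun c _ =>
      mul_nonneg (mul_nonneg (hl0 a) (hm0 c)) (Complex.normSq_nonneg _)
  have : ((X - Y) * (X - Y)).trace = (X * X).trace + (Y * Y).trace - 2 * (X * Y).trace := by
    rw [sub_mul, mul_sub, mul_sub, Matrix.trace_sub, Matrix.trace_sub, Matrix.trace_sub,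
      Matrix.trace_mul_comm Y X]
    ring
  rw [this]
  have h2 : ((2 : ℂ) * (X * Y).trace).re = 2 * (X * Y).trace.re := by simp
  rw [Complex.sub_re, Complex.add_re, h2]
  linarith [hsq hX, hsq hY]

lemma neg_trace_mul_matLog_mem {X Y : Matrix ι ι ℂ} (hX : IsState X) (hY : IsState Y)
    {c : ℝ} (hc : 0 < c) (hcY : ∀ i, c ≤ hY.1.isHermitian.eigenvalues i) :
    -(X * matLog Y).trace.re ≤ -Real.logb 2 c := by
  obtain ⟨U, hU, h1, -⟩ := exists_diagConj hX.1.isHermitian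
  obtain ⟨V, hV, -, h2⟩ := exists_diagConj hY.1.isHermitian
  obtain ⟨hl0, hl1⟩ := isState_eigenvalues hX
  have h3 : X * matLog Y = diagConj U hX.1.isHermitian.eigenvalues *
      diagConj V (fun i => Real.logb 2 (hY.1.isHermitian.eigenvalues i)) :=
    congrArg₂ (· * ·) h1 h2
  rw [h3, trace_diagConj_mul, Complex.ofReal_re, neg_le_neg_iff]
  have hG := star_mul_mem_unitaryGroup hU hV
  calc Real.logb 2 c = ∑ a, ∑ b, hX.1.isHermitian.eigenvalues a * Real.logb 2 c *
        Complex.normSq ((star V * U) b a) := by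
        simp only [← Finset.mul_sum, sum_normSq_col hG, mul_one, ← Finset.sum_mul, hl1, one_mul]
    _ ≤ _ := Finset.sum_le_sum fun a _ => Finset.sum_le_sum fun b _ =>
        mul_le_mul_of_nonneg_right (mul_le_mul_of_nonneg_left
          (Real.logb_le_logb_of_le one_lt_two hc (hcY b)) (hl0 a)) (Complex.normSq_nonneg _)

lemma trace_matLog_nonpos {Y : Matrix ι ι ℂ} (hY : IsState Y) : (matLog Y).trace.re ≤ 0 := by
  obtain ⟨V, hV, -, h2⟩ := exists_diagConj hY.1.isHermitian
  rw [h2, trace_diagConj hV, Complex.ofReal_re]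
  exact Finset.sum_nonpos fun i _ => Real.logb_nonpos one_lt_two
    ((isState_eigenvalues hY).1 i) (eigenvalues_le_one hY i)

lemma mul_logb_self_nonpos {x : ℝ} (h0 : 0 ≤ x) (h1 : x ≤ 1) : x * Real.logb 2 x ≤ 0 :=
  mul_nonpos_of_nonneg_of_nonpos h0 (Real.logb_nonpos one_lt_two h0 h1)

lemma entropy_nonneg {X : Matrix ι ι ℂ} (hX : IsState X) : 0 ≤ entropy X := by
  rw [entropy_eq_sum_eigenvalues hX.1.isHermitian, neg_nonneg]
  exact Finset.sum_nonpos fun i _ =>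
    mul_logb_self_nonpos ((isState_eigenvalues hX).1 i) (eigenvalues_le_one hX i)

lemma entropy_le {X : Matrix ι ι ℂ} (hX : IsState X) :
    entropy X ≤ Fintype.card ι / Real.log 2 := by
  rw [entropy_eq_sum_eigenvalues hX.1.isHermitian, ← Finset.sum_neg_distrib]
  have hlog2 : 0 < Real.log 2 := Real.log_pos one_lt_two
  have : ∀ i ∈ (Finset.univ : Finset ι), -(hX.1.isHermitian.eigenvalues i *
      Real.logb 2 (hX.1.isHermitian.eigenvalues i)) ≤ 1 / Real.log 2 := by
    intro i _
    have h0 := (isState_eigenvalues hX).1 i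
    set x := hX.1.isHermitian.eigenvalues i
    rw [Real.logb, ← mul_div_assoc, ← neg_div]
    refine div_le_div_of_nonneg_right ?_ hlog2.le
    rcases h0.eq_or_lt with h | h
    · rw [← h]; simp
    · have := Real.one_sub_inv_le_log_of_pos h
      have h2 := mul_le_mul_of_nonneg_left this h.le
      rw [mul_sub, mul_inv_cancel₀ h.ne'] at h2
      linarith
  refine (Finset.sum_le_sum this).trans ?_
  rw [Finset.sum_const, Finset.card_univ, nsmul_eq_mul, mul_one_div]

end Depolarize

lemma sum_smul_isState {ι κ : Type*} [Fintype ι] [Fintype κ] {p : κ → ℝ} (hp : IsProbDist p)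
    {b : κ → Matrix ι ι ℂ} (hb : ∀ x, IsState (b x)) : IsState (∑ x, (p x : ℂ) • b x) := by
  refine ⟨Matrix.posSemidef_sum _ fun x _ => (hb x).1.smul (by exact_mod_cast hp.1 x), ?_⟩
  rw [Matrix.trace_sum]
  simp only [Matrix.trace_smul, (hb _).2, smul_eq_mul, mul_one]
  exact_mod_cast hp.2

section Minimax

variable {ι : Type*} [Fintype ι] [DecidableEq ι]

lemma depol_sum_cons {η t : ℝ} {n : ℕ} {p : Fin n → ℝ} (b : Fin n → Matrix ι ι ℂ)
    (b₀ : Matrix ι ι ℂ) :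
    depol η (∑ x : Fin (n + 1), (((Fin.cons t (fun x => (1 - t) * p x) : Fin (n + 1) → ℝ) x : ℝ) : ℂ)
      • (Fin.cons b₀ b : Fin (n + 1) → Matrix ι ι ℂ) x) =
    ((1 - t : ℝ) : ℂ) • depol η (∑ x, (p x : ℂ) • b x) + (t : ℂ) • depol η b₀ := by
  rw [Fin.sum_univ_succ]
  simp only [Fin.cons_zero, Fin.cons_succ, depol]
  have : ∑ x, (((1 - t) * p x : ℝ) : ℂ) • b x = ((1 - t : ℝ) : ℂ) • ∑ x, (p x : ℂ) • b x := by
    rw [Finset.smul_sum]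
    refine Finset.sum_congr rfl fun x _ => ?_
    rw [smul_smul]; push_cast; rfl
  rw [this]
  push_cast
  module

/-- Approximate minimax: a full-rank state achieving the divergence radius of a family of
states up to an arbitrarily small error, simultaneously for all members of the family. -/
lemma exists_common_reference [Nonempty ι] {𝓔 : Type*} [Nonempty 𝓔] (b : 𝓔 → Matrix ι ι ℂ)
    (hb : ∀ E, IsState (b E)) (s : 𝓔 → ℝ) (J : ℝ)
    (hJ : ∀ (n : ℕ) (p : Fin n → ℝ) (E : Fin n → 𝓔), IsProbDist p →
      entropy (∑ x, (p x : ℂ) • b (E x)) - ∑ x, p x * s (E x) ≤ J) {θ : ℝ} (hθ : 0 < θ) :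
    ∃ (Y : Matrix ι ι ℂ) (hY : IsState Y), (∀ i, 0 < hY.1.isHermitian.eigenvalues i) ∧
      ∀ E, -(b E * matLog Y).trace.re - s E ≤ J + θ := by
  have hcard : (0 : ℝ) < Fintype.card ι := by exact_mod_cast Fintype.card_pos
  have hlog2 : 0 < Real.log 2 := Real.log_pos one_lt_two
  have hκ : 0 < θ / 3 := by positivity
  set κ := θ / 3
  obtain ⟨δ, hδ, hdep⟩ := exists_depol_entropy_le (ι := ι) hκ
  obtain ⟨η, hη0, hη1, hηδ, hηlog⟩ : ∃ η : ℝ, 0 < η ∧ η < 1 ∧ η < δ ∧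
      η * -Real.logb 2 (η / Fintype.card ι) ≤ κ := by
    have hcont : Continuous fun x : ℝ =>
        Fintype.card ι * (-(x * Real.log x) / Real.log 2) :=
      continuous_const.mul (Real.continuous_mul_log.neg.div_const _)
    have ht := (hcont.comp (continuous_id.div_const (Fintype.card ι : ℝ))).tendsto 0
    simp only [Function.comp_def, id, zero_div, Real.log_zero, mul_zero, neg_zero] at ht
    have hev := (ht.eventually (gt_mem_nhds hκ)).filter_mono
      (nhdsWithin_le_nhds (s := Set.Ioi (0 : ℝ)))
    have hev2 : ∀ᶠ x : ℝ in nhdsWithin 0 (Set.Ioi 0), x < min 1 δ :=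
      nhdsWithin_le_nhds (gt_mem_nhds (lt_min one_pos hδ))
    obtain ⟨η, ⟨h1, h2⟩, h3⟩ := ((hev.and hev2).and self_mem_nhdsWithin).exists
    refine ⟨η, h3, h2.trans_le (min_le_left _ _), h2.trans_le (min_le_right _ _), ?_⟩
    refine le_of_eq_of_le ?_ h1.le
    rw [Real.logb]
    field_simp
  set c := η / Fintype.card ι with hcdef
  have hc : 0 < c := div_pos hη0 hcard
  set C : ℝ := 2 / (c * Real.log 2) with hC
  have hC0 : 0 ≤ C := by positivity
  obtain ⟨t, ht0, ht1, htC⟩ : ∃ t : ℝ, 0 < t ∧ t < 1 ∧ t * (C + 1) ≤ κ := by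
    refine ⟨min (1 / 2) (κ / (C + 1)), lt_min (by norm_num) (by positivity),
      (min_le_left _ _).trans_lt (by norm_num), ?_⟩
    calc _ ≤ κ / (C + 1) * (C + 1) := mul_le_mul_of_nonneg_right (min_le_right _ _) (by positivity)
      _ = κ := div_mul_cancel₀ _ (by positivity)
  let S : Set ℝ := { r | ∃ (n : ℕ) (p : Fin n → ℝ) (E : Fin n → 𝓔), IsProbDist p ∧
    r = entropy (depol η (∑ x, (p x : ℂ) • b (E x))) - ∑ x, p x * s (E x) }
  have hSub : ∀ r ∈ S, r ≤ J + κ := by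
    rintro r ⟨n, p, E, hp, rfl⟩
    have h1 := hdep η hη0.le hηδ hη1.le _ (sum_smul_isState hp fun x => hb (E x))
    have h2 := hJ n p E hp
    linarith
  have hSbdd : BddAbove S := ⟨J + κ, hSub⟩
  have hSne : S.Nonempty := by
    obtain ⟨E₀⟩ := ‹Nonempty 𝓔›
    exact ⟨_, 1, fun _ => 1, fun _ => E₀, ⟨fun _ => zero_le_one, by simp⟩, rfl⟩
  obtain ⟨r, ⟨n, p, E, hp, hr⟩, hrS⟩ := exists_lt_of_lt_csSup hSne
    (show sSup S - t ^ 2 < sSup S by have : 0 < t ^ 2 := by positivity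
                                     linarith)
  set a := ∑ x, (p x : ℂ) • b (E x) with ha
  have haS : IsState a := sum_smul_isState hp fun x => hb (E x)
  set w := ∑ x, p x * s (E x) with hw
  have hY := depol_isState hη0.le hη1.le haS
  set Y := depol η a with hYdef
  have hcY : ∀ i, c ≤ hY.1.isHermitian.eigenvalues i := eigenvalues_depol_ge hη0.le hη1.le haS
  refine ⟨Y, hY, fun i => hc.trans_le (hcY i), fun E₀ => ?_⟩
  have hZ := depol_isState hη0.le hη1.le (hb E₀)
  set Z := depol η (b E₀) with hZdef
  have hp' : IsProbDist (Fin.cons t (fun x => (1 - t) * p x) : Fin (n + 1) → ℝ) := by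
    refine ⟨fun x => ?_, ?_⟩
    · refine Fin.cases ?_ (fun x => ?_) x
      · exact ht0.le
      · exact mul_nonneg (sub_nonneg.2 ht1.le) (hp.1 x)
    · rw [Fin.sum_univ_succ]
      simp only [Fin.cons_zero, Fin.cons_succ, ← Finset.mul_sum, hp.2]
      ring
  have hcomp : ∀ x, b ((Fin.cons E₀ E : Fin (n + 1) → 𝓔) x) =
      (Fin.cons (b E₀) (fun x => b (E x)) : Fin (n + 1) → Matrix ι ι ℂ) x := by
    intro x; refine Fin.cases ?_ (fun x => ?_) x <;> simp
  have hX := depol_isState hη0.le hη1.le (sum_smul_isState hp'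
    fun x => hb ((Fin.cons E₀ E : Fin (n + 1) → 𝓔) x))
  have hmem := le_csSup hSbdd ⟨n + 1, _, (Fin.cons E₀ E : Fin (n + 1) → 𝓔), hp', rfl⟩
  simp only [hcomp] at hX hmem
  rw [depol_sum_cons, ← ha, ← hYdef, ← hZdef] at hX hmem
  rw [Fin.sum_univ_succ] at hmem
  simp only [Fin.cons_zero, Fin.cons_succ, mul_assoc, ← Finset.mul_sum] at hmem
  rw [← hw] at hmem
  have hchi := entropy_ge_of_eigenvalues_ge hX hY hc hcY
  have hdiff : ((1 - t : ℝ) : ℂ) • Y + (t : ℂ) • Z - Y = (t : ℂ) • (Z - Y) := by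
    push_cast; module
  rw [hdiff, Matrix.add_mul, Matrix.smul_mul, Matrix.smul_mul, Matrix.smul_mul, Matrix.mul_smul,
    Matrix.trace_add, Matrix.trace_smul, Matrix.trace_smul, Matrix.trace_smul, Matrix.trace_smul,
    smul_eq_mul, smul_eq_mul, smul_eq_mul, smul_eq_mul, Complex.add_re, Complex.re_ofReal_mul,
    Complex.re_ofReal_mul, Complex.re_ofReal_mul, Complex.re_ofReal_mul] at hchi
  have hsq := trace_sub_sq_le hZ hY
  have hZY : (Z * matLog Y).trace.re = (1 - η) * (b E₀ * matLog Y).trace.re +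
      η / Fintype.card ι * (matLog Y).trace.re := by
    rw [hZdef, depol, Matrix.add_mul, Matrix.smul_mul, Matrix.smul_mul, Matrix.one_mul,
      Matrix.trace_add, Matrix.trace_smul, Matrix.trace_smul, smul_eq_mul, smul_eq_mul,
      Complex.add_re, Complex.re_ofReal_mul, Complex.re_ofReal_mul]
  have hYent : entropy Y = -(Y * matLog Y).trace.re := rfl
  have hlogneg := mul_nonpos_of_nonneg_of_nonpos hc.le (trace_matLog_nonpos hY)
  have hv := neg_trace_mul_matLog_mem (hb E₀) hY hc hcY
  have hv' := mul_le_mul_of_nonneg_left hv hη0.le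
  have hle := hSub _ ⟨n, p, E, hp, rfl⟩
  rw [← ha, ← hYdef, ← hw] at hle
  rw [← hcdef] at hZY
  set yy := (Y * matLog Y).trace.re
  set zy := (Z * matLog Y).trace.re
  set v := (b E₀ * matLog Y).trace.re
  have hquad : t * (t * ((Z - Y) * (Z - Y)).trace.re) / (c * Real.log 2) ≤ t * (t * C) := by
    rw [hC, ← mul_div_assoc, ← mul_div_assoc]
    refine div_le_div_of_nonneg_right ?_ (by positivity)
    exact mul_le_mul_of_nonneg_left (mul_le_mul_of_nonneg_left hsq ht0.le) ht0.le
  have hmain : t * (-zy - s E₀) ≤ t * (entropy Y - w + t * C + t) := by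
    nlinarith
  have hmain' := le_of_mul_le_mul_left hmain ht0
  have : θ = κ + κ + κ := by simp only [κ]; ring
  rw [this]
  linarith
end Minimax

section OneShot

variable {ι : Type*} [Fintype ι] [DecidableEq ι]

lemma trace_mul_diagConj (Λ U : Matrix ι ι ℂ) (d : ι → ℝ) :
    (Λ * diagConj U d).trace.re = ∑ a, d a * ((star U * Λ * U) a a).re := by
  have h : (Λ * diagConj U d).trace = (diagonal (fun i => (d i : ℂ)) * (star U * Λ * U)).trace := by
    rw [diagConj, Matrix.mul_assoc U, Matrix.trace_mul_comm, Matrix.mul_assoc U, Matrix.mul_assoc,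
      Matrix.trace_mul_comm]
    simp only [Matrix.mul_assoc]
  rw [h, Matrix.trace, Complex.re_sum]
  refine Finset.sum_congr rfl fun a _ => ?_
  rw [Matrix.diag_apply, Matrix.diagonal_mul, Complex.re_ofReal_mul]

/-- One-shot bound on the probability of the outcome `Λ` on the state `U diag(l) U*` in terms of
its probability on `V diag(m) V*` and the weights of atypical eigenvectors. -/
lemma trace_mul_diagConj_le {Λ U V : Matrix ι ι ℂ} (hΛ : Λ.PosSemidef)
    (hΛ1 : (1 - Λ).PosSemidef) (hU : U ∈ Matrix.unitaryGroup ι ℂ)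
    (hV : V ∈ Matrix.unitaryGroup ι ℂ) {l m : ι → ℝ} (hl : ∀ a, 0 ≤ l a) (hm : ∀ c, 0 ≤ m c)
    {α β : ℝ} (hα : 0 < α) (hβ : 0 < β) :
    (Λ * diagConj U l).trace.re ≤ 2 * (α / β) * (Λ * diagConj V m).trace.re +
      2 * ∑ a, ∑ c, (if m c < β then l a * Complex.normSq ((star V * U) c a) else 0) +
      ∑ a, (if α < l a then l a else 0) := by
  have hVV := Matrix.mem_unitaryGroup_iff.1 hV
  have hVV' := Matrix.mem_unitaryGroup_iff'.1 hV
  have hG := star_mul_mem_unitaryGroup hU hV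
  set G := star V * U with hGdef
  set M := star V * Λ * V with hMdef
  have hM : M.PosSemidef := hΛ.conjTranspose_mul_mul_same V
  have hM1 : (1 - M).PosSemidef := by
    have := hΛ1.conjTranspose_mul_mul_same V
    rwa [Matrix.mul_sub, Matrix.sub_mul, Matrix.mul_one, ← Matrix.star_eq_conjTranspose,
      hVV'] at this
  have hUG : star U * Λ * U = star G * M * G := by
    have : U = V * G := by rw [hGdef, ← Matrix.mul_assoc, hVV, Matrix.one_mul]
    conv_lhs => rw [this, star_mul]
    simp only [hMdef, Matrix.mul_assoc]
  set Q : Matrix ι ι ℂ := diagonal (fun c => if m c < β then 0 else 1) with hQ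
  set Q' : Matrix ι ι ℂ := diagonal (fun c => if m c < β then 1 else 0) with hQ'
  have hQQ' : Q + Q' = 1 := by
    rw [hQ, hQ', Matrix.diagonal_add, ← Matrix.diagonal_one]
    congr 1; ext c; split_ifs <;> simp
  have hGAB : G = Q * G + Q' * G := by rw [← Matrix.add_mul, hQQ', Matrix.one_mul]
  have hQs : star Q = Q := by
    rw [Matrix.star_eq_conjTranspose, hQ, Matrix.diagonal_conjTranspose]
    congr 1; ext c; simp only [Pi.star_apply]; split_ifs <;> simp
  set A := Q * G with hA
  set B := Q' * G with hB
  have hpar : star G * M * G + star (A - B) * M * (A - B) =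
      (2 : ℂ) • (star A * M * A) + (2 : ℂ) • (star B * M * B) := by
    rw [hGAB, star_add, star_sub, two_smul, two_smul]
    noncomm_ring
  have hdiag : ∀ a, ((star G * M * G) a a).re ≤
      2 * ((star A * M * A) a a).re + 2 * ((star B * B) a a).re := by
    intro a
    have h1 := congrArg Complex.re (congrFun (congrFun hpar a) a)
    simp only [Matrix.add_apply, Matrix.smul_apply, Complex.add_re, smul_eq_mul] at h1
    have h2 : ∀ z : ℂ, ((2 : ℂ) * z).re = 2 * z.re := fun z => by simp
    rw [h2, h2] at h1
    have h3 := (Complex.le_def.1 ((hM.conjTranspose_mul_mul_same (A - B)).diag_nonneg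
      (i := a))).1
    have h4 := (Complex.le_def.1 ((hM1.conjTranspose_mul_mul_same B).diag_nonneg (i := a))).1
    rw [Matrix.mul_sub, Matrix.sub_mul, Matrix.mul_one, Matrix.sub_apply, Complex.sub_re] at h4
    simp only [← Matrix.star_eq_conjTranspose, Complex.zero_re] at h3 h4
    linarith
  have hApos : ∀ a, 0 ≤ ((star A * M * A) a a).re := fun a =>
    (Complex.le_def.1 ((hM.conjTranspose_mul_mul_same A).diag_nonneg (i := a))).1
  have hMpos : ∀ c, 0 ≤ (M c c).re := fun c => (Complex.le_def.1 (hM.diag_nonneg (i := c))).1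
  have hBB : ∀ a, ((star B * B) a a).re =
      ∑ c, (if m c < β then Complex.normSq (G c a) else 0) := by
    intro a
    rw [Matrix.mul_apply, Complex.re_sum]
    refine Finset.sum_congr rfl fun c _ => ?_
    rw [Matrix.star_apply, hB, hQ', Matrix.diagonal_mul]
    split_ifs
    · rw [one_mul, RCLike.star_def, ← Complex.normSq_eq_conj_mul_self, Complex.ofReal_re]
    · simp
  have hGle : ∀ a, ((star G * M * G) a a).re ≤ 1 := by
    intro a
    have h4 := (Complex.le_def.1 ((hM1.conjTranspose_mul_mul_same G).diag_nonneg (i := a))).1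
    rw [Matrix.mul_sub, Matrix.sub_mul, Matrix.mul_one, Matrix.sub_apply, Complex.sub_re,
      ← Matrix.star_eq_conjTranspose, Matrix.mem_unitaryGroup_iff'.1 hG, Matrix.one_apply_eq] at h4
    simp only [Complex.zero_re, Complex.one_re] at h4
    linarith
  have htr : ∑ a, ((star A * M * A) a a).re = ∑ c, (if m c < β then 0 else (M c c).re) := by
    have h1 : (star A * M * A).trace = (Q * M * Q).trace := by
      rw [hA, star_mul, hQs, Matrix.mul_assoc, Matrix.mul_assoc, Matrix.trace_mul_comm]
      have : Q * (M * (Q * G)) * star G = Q * (M * (Q * (G * star G))) := by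
        simp only [Matrix.mul_assoc]
      rw [this, Matrix.mem_unitaryGroup_iff.1 hG, Matrix.mul_one]
      simp only [Matrix.mul_assoc]
    have h2 := congrArg Complex.re h1
    rw [Matrix.trace, Matrix.trace, Complex.re_sum, Complex.re_sum] at h2
    simp only [Matrix.diag_apply] at h2
    rw [h2]
    refine Finset.sum_congr rfl fun c _ => ?_
    rw [hQ, Matrix.mul_diagonal, Matrix.diagonal_mul]
    split_ifs <;> simp
  rw [trace_mul_diagConj, trace_mul_diagConj, hUG, ← hMdef]
  have step : ∀ a ∈ (Finset.univ : Finset ι), l a * ((star G * M * G) a a).re ≤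
      2 * α * ((star A * M * A) a a).re +
      2 * ∑ c, (if m c < β then l a * Complex.normSq (G c a) else 0) +
      (if α < l a then l a else 0) := by
    intro a _
    have e1 : ∑ c, (if m c < β then l a * Complex.normSq (G c a) else 0) =
        l a * ((star B * B) a a).re := by
      rw [hBB, Finset.mul_sum]
      refine Finset.sum_congr rfl fun c _ => ?_
      split_ifs <;> simp
    have e2 : 0 ≤ ((star B * B) a a).re := by
      rw [hBB]
      refine Finset.sum_nonneg fun c _ => ?_
      split_ifs
      · exact Complex.normSq_nonneg _
      · exact le_rfl
    rw [e1]
    have := mul_nonneg (hl a) e2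
    split_ifs with h
    · have h1 := mul_le_mul_of_nonneg_left (hGle a) (hl a)
      have := mul_nonneg hα.le (hApos a)
      linarith
    · have h1 := mul_le_mul_of_nonneg_left (hdiag a) (hl a)
      have h2 := mul_le_mul_of_nonneg_right (not_lt.1 h) (hApos a)
      nlinarith
  refine (Finset.sum_le_sum step).trans ?_
  rw [Finset.sum_add_distrib, Finset.sum_add_distrib, ← Finset.mul_sum, ← Finset.mul_sum, htr]
  gcongr ?_ + _ + _
  have hQm : β * ∑ c, (if m c < β then 0 else (M c c).re) ≤ ∑ c, m c * (M c c).re := by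
    rw [Finset.mul_sum]
    refine Finset.sum_le_sum fun c _ => ?_
    split_ifs with h
    · rw [mul_zero]; exact mul_nonneg (hm c) (hMpos c)
    · exact mul_le_mul_of_nonneg_right (not_lt.1 h) (hMpos c)
  calc 2 * α * ∑ c, (if m c < β then 0 else (M c c).re)
      = 2 * (α / β) * (β * ∑ c, (if m c < β then 0 else (M c c).re)) := by field_simp
    _ ≤ _ := mul_le_mul_of_nonneg_left hQm (by positivity)

end OneShot

section Chebyshev

variable {n : ℕ} {X : Type*} [Fintype X]

lemma sum_pi_prod (f : Fin n → X → ℝ) : ∑ c : Fin n → X, ∏ i, f i (c i) = ∏ i, ∑ x, f i x := by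
  classical
  rw [Finset.prod_univ_sum, Fintype.piFinset_univ]

/-- The second moment of a sum of independent centred variables. -/
lemma sum_pi_prod_mul_sq {r Z : Fin n → X → ℝ} (hr : ∀ i, ∑ x, r i x = 1)
    (hZ : ∀ i, ∑ x, r i x * Z i x = 0) :
    ∑ c : Fin n → X, (∏ i, r i (c i)) * (∑ i, Z i (c i)) ^ 2 = ∑ i, ∑ x, r i x * Z i x ^ 2 := by
  classical
  have hexp : ∀ i j : Fin n, ∑ c : Fin n → X, (∏ k, r k (c k)) * (Z i (c i) * Z j (c j)) =
      if i = j then ∑ x, r i x * Z i x ^ 2 else 0 := by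
    intro i j
    have h1 : ∀ c : Fin n → X, (∏ k, r k (c k)) * (Z i (c i) * Z j (c j)) =
        ∏ k, r k (c k) * ((if k = i then Z k (c k) else 1) * (if k = j then Z k (c k) else 1)) := by
      intro c
      rw [Finset.prod_mul_distrib, Finset.prod_mul_distrib, Finset.prod_ite_eq' Finset.univ i,
        Finset.prod_ite_eq' Finset.univ j]
      simp
    simp only [h1]
    rw [sum_pi_prod (fun k x => r k x * ((if k = i then Z k x else 1) *
      (if k = j then Z k x else 1)))]
    split_ifs with h
    · subst h
      rw [Finset.prod_eq_single i]
      · simp [sq]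
      · intro k _ hk; simp [hk, hr]
      · simp
    · refine Finset.prod_eq_zero (Finset.mem_univ i) ?_
      simp [h, hZ]
  simp only [sq (∑ i, Z i _)]
  simp only [Finset.sum_mul_sum]
  simp only [Finset.mul_sum]
  rw [Finset.sum_comm]
  refine Finset.sum_congr rfl fun i _ => ?_
  rw [Finset.sum_comm]
  simp only [hexp, Finset.sum_ite_eq, Finset.mem_univ, if_true]

/-- Chebyshev inequality for a product of finite probability distributions. -/
lemma chebyshev_pi {r Y : Fin n → X → ℝ} (hr0 : ∀ i x, 0 ≤ r i x) (hr : ∀ i, ∑ x, r i x = 1)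
    {C δ : ℝ} (hC : ∀ i, ∑ x, r i x * Y i x ^ 2 ≤ C) (hδ : 0 < δ) (hn : 0 < n)
    (P : (Fin n → X) → Prop) [DecidablePred P]
    (hP : ∀ c, P c → (∀ i, r i (c i) ≠ 0) →
      n * δ ≤ |∑ i, (Y i (c i) - ∑ x, r i x * Y i x)|) :
    ∑ c : Fin n → X, (if P c then ∏ i, r i (c i) else 0) ≤ C / (n * δ ^ 2) := by
  have hn' : (0 : ℝ) < n := by exact_mod_cast hn
  set Z : Fin n → X → ℝ := fun i x => Y i x - ∑ x, r i x * Y i x with hZdef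
  have hZ : ∀ i, ∑ x, r i x * Z i x = 0 := by
    intro i
    simp only [hZdef, mul_sub, Finset.sum_sub_distrib, ← Finset.sum_mul, hr, one_mul, sub_self]
  have hvar : ∀ i, ∑ x, r i x * Z i x ^ 2 ≤ C := by
    intro i
    refine le_trans ?_ (hC i)
    have : ∀ x, r i x * Z i x ^ 2 = r i x * Y i x ^ 2 - 2 * (∑ x, r i x * Y i x) * (r i x * Y i x)
        + (∑ x, r i x * Y i x) ^ 2 * r i x := by
      intro x; simp only [hZdef]; ring
    simp only [this, Finset.sum_add_distrib, Finset.sum_sub_distrib, ← Finset.mul_sum, hr]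
    nlinarith [sq_nonneg (∑ x, r i x * Y i x)]
  have hsum : ∑ c : Fin n → X, (∏ i, r i (c i)) * (∑ i, Z i (c i)) ^ 2 ≤ n * C := by
    rw [sum_pi_prod_mul_sq hr hZ]
    refine (Finset.sum_le_sum fun i _ => hvar i).trans ?_
    simp
  have hterm : ∀ c ∈ (Finset.univ : Finset (Fin n → X)),
      (n * δ) ^ 2 * (if P c then ∏ i, r i (c i) else 0) ≤
        (∏ i, r i (c i)) * (∑ i, Z i (c i)) ^ 2 := by
    intro c _
    have h0 : 0 ≤ ∏ i, r i (c i) := Finset.prod_nonneg fun i _ => hr0 i _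
    split_ifs with h
    · rcases h0.eq_or_lt with h1 | h1
      · rw [← h1]; simp
      · have h2 := hP c h fun i => Finset.prod_ne_zero_iff.1 h1.ne' i (Finset.mem_univ i)
        rw [mul_comm]
        refine mul_le_mul_of_nonneg_left ?_ h0
        rw [← sq_abs (∑ i, Z i (c i))]
        exact pow_le_pow_left₀ (by positivity) h2 2
    · rw [mul_zero]; positivity
  have := (Finset.sum_le_sum hterm).trans hsum
  rw [← Finset.mul_sum] at this
  rw [le_div_iff₀ (by positivity)]
  have h3 : n * ((∑ c : Fin n → X, (if P c then ∏ i, r i (c i) else 0)) * (n * δ ^ 2)) ≤ n * C := by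
    refine le_trans (le_of_eq ?_) this
    ring
  exact le_of_mul_le_mul_left h3 hn'

end Chebyshev

section Tens

variable {n : ℕ} {X : Type*}

/-- Tensor product of matrices indexed by functions. -/
def tens (M : Fin n → Matrix X X ℂ) : Matrix (Fin n → X) (Fin n → X) ℂ :=
  Matrix.of fun p q => ∏ i, M i (p i) (q i)

lemma star_tens (M : Fin n → Matrix X X ℂ) : star (tens M) = tens fun i => star (M i) := by
  ext p q
  simp [tens]

lemma normSq_tens (M : Fin n → Matrix X X ℂ) (p q : Fin n → X) :
    Complex.normSq (tens M p q) = ∏ i, Complex.normSq (M i (p i) (q i)) := by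
  simp only [tens, Matrix.of_apply, map_prod]

lemma tens_diagonal [DecidableEq X] (d : Fin n → X → ℂ) :
    tens (fun i => diagonal (d i)) = diagonal fun c => ∏ i, d i (c i) := by
  ext p q
  simp only [tens, Matrix.of_apply]
  by_cases h : p = q
  · subst h; simp
  · rw [Matrix.diagonal_apply_ne _ h]
    obtain ⟨i, hi⟩ := Function.ne_iff.1 h
    exact Finset.prod_eq_zero (Finset.mem_univ i) (Matrix.diagonal_apply_ne _ hi)

lemma tens_one [DecidableEq X] : tens (fun _ : Fin n => (1 : Matrix X X ℂ)) = 1 := by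
  have h := tens_diagonal (n := n) (X := X) fun _ _ => 1
  simpa using h

variable [Fintype X]

lemma tens_mul_tens (M N : Fin n → Matrix X X ℂ) :
    tens M * tens N = tens fun i => M i * N i := by
  classical
  ext p q
  simp only [tens, Matrix.mul_apply, Matrix.of_apply, ← Finset.prod_mul_distrib]
  rw [Finset.prod_univ_sum, Fintype.piFinset_univ]

lemma trace_tens (M : Fin n → Matrix X X ℂ) : (tens M).trace = ∏ i, (M i).trace := by
  classical
  simp only [tens, Matrix.trace, Matrix.diag_apply, Matrix.of_apply]
  rw [Finset.prod_univ_sum, Fintype.piFinset_univ]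

variable [DecidableEq X]

lemma tens_mem_unitaryGroup {U : Fin n → Matrix X X ℂ}
    (hU : ∀ i, U i ∈ Matrix.unitaryGroup X ℂ) :
    tens U ∈ Matrix.unitaryGroup (Fin n → X) ℂ := by
  rw [Matrix.mem_unitaryGroup_iff, star_tens, tens_mul_tens]
  simp only [Matrix.mem_unitaryGroup_iff.1 (hU _), tens_one]

lemma tens_diagConj (U : Fin n → Matrix X X ℂ) (d : Fin n → X → ℝ) :
    tens (fun i => diagConj (U i) (d i)) = diagConj (tens U) fun c => ∏ i, d i (c i) := by
  simp only [diagConj, ← tens_mul_tens, tens_diagonal, star_tens, Complex.ofReal_prod]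

end Tens

section NShot

variable {n : ℕ} {X : Type*} [Fintype X] [DecidableEq X]

/-- `n`-shot bound for product states, with atypical weights controlled by second moments. -/
lemma trace_mul_tens_le {U : Fin n → Matrix X X ℂ} {W : Matrix X X ℂ}
    (hU : ∀ i, U i ∈ Matrix.unitaryGroup X ℂ) (hW : W ∈ Matrix.unitaryGroup X ℂ)
    {l : Fin n → X → ℝ} (hl : ∀ i a, 0 ≤ l i a) (hl1 : ∀ i, ∑ a, l i a = 1)
    {m : X → ℝ} (hm : ∀ c, 0 ≤ m c)
    (hr0 : ∀ i c, m c = 0 → ∑ a, l i a * Complex.normSq ((star W * U i) c a) = 0)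
    {C δ : ℝ} (hC : ∀ i, ∑ a, l i a * Real.logb 2 (l i a) ^ 2 ≤ C)
    (hC' : ∀ i, ∑ c, (∑ a, l i a * Complex.normSq ((star W * U i) c a)) *
      Real.logb 2 (m c) ^ 2 ≤ C) (hδ : 0 < δ) (hn : 0 < n)
    {Λ : Matrix (Fin n → X) (Fin n → X) ℂ} (hΛ : Λ.PosSemidef) (hΛ1 : (1 - Λ).PosSemidef) :
    (Λ * tens fun i => diagConj (U i) (l i)).trace.re ≤
      2 * (2 : ℝ) ^ (∑ i, (∑ a, l i a * Real.logb 2 (l i a) -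
        ∑ c, (∑ a, l i a * Complex.normSq ((star W * U i) c a)) * Real.logb 2 (m c)) +
        2 * (n * δ)) * (Λ * tens fun _ => diagConj W m).trace.re + 3 * (C / (n * δ ^ 2)) := by
  set r : Fin n → X → ℝ := fun i c => ∑ a, l i a * Complex.normSq ((star W * U i) c a) with hr
  set al : ℝ := ∑ i, ∑ a, l i a * Real.logb 2 (l i a) + n * δ with hal
  set be : ℝ := ∑ i, ∑ c, r i c * Real.logb 2 (m c) - n * δ with hbe
  have h2 : (0 : ℝ) < 2 := two_pos
  have hr_nonneg : ∀ i c, 0 ≤ r i c := fun i c =>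
    Finset.sum_nonneg fun a _ => mul_nonneg (hl i a) (Complex.normSq_nonneg _)
  have hr_sum : ∀ i, ∑ c, r i c = 1 := by
    intro i
    simp only [hr]
    rw [Finset.sum_comm]
    simp only [← Finset.mul_sum, sum_normSq_col (star_mul_mem_unitaryGroup (hU i) hW), mul_one, hl1]
  have key := trace_mul_diagConj_le hΛ hΛ1 (tens_mem_unitaryGroup hU)
    (tens_mem_unitaryGroup fun _ => hW) (l := fun c => ∏ i, l i (c i)) (m := fun c => ∏ i, m (c i))
    (fun c => Finset.prod_nonneg fun i _ => hl i _) (fun c => Finset.prod_nonneg fun i _ => hm _)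
    (Real.rpow_pos_of_pos h2 al) (Real.rpow_pos_of_pos h2 be)
  rw [← tens_diagConj, ← tens_diagConj (fun _ => W) (fun _ => m), ← Real.rpow_sub h2] at key
  have hexp : al - be = ∑ i, (∑ a, l i a * Real.logb 2 (l i a) -
      ∑ c, r i c * Real.logb 2 (m c)) + 2 * (n * δ) := by
    rw [hal, hbe, Finset.sum_sub_distrib]; ring
  rw [hexp] at key
  have hA : ∑ a : Fin n → X, (if (2 : ℝ) ^ al < ∏ i, l i (a i) then ∏ i, l i (a i) else 0) ≤
      C / (n * δ ^ 2) := by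
    refine chebyshev_pi hl hl1 hC hδ hn _ fun c hc hne => ?_
    have hlt : al < ∑ i, Real.logb 2 (l i (c i)) := by
      rw [← Real.logb_prod _ _ fun i _ => hne i]
      rw [← Real.logb_rpow h2 (by norm_num : (2 : ℝ) ≠ 1) (x := al)]
      exact Real.logb_lt_logb one_lt_two (Real.rpow_pos_of_pos h2 al) hc
    refine le_trans ?_ (le_abs_self _)
    rw [Finset.sum_sub_distrib]
    rw [hal] at hlt
    linarith
  have hB : ∑ a : Fin n → X, ∑ c : Fin n → X, (if ∏ i, m (c i) < (2 : ℝ) ^ be then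
      (∏ i, l i (a i)) * Complex.normSq
          ((star (tens fun _ => W) * tens U : Matrix (Fin n → X) (Fin n → X) ℂ) c a) else 0) ≤
      C / (n * δ ^ 2) := by
    rw [Finset.sum_comm]
    have e : ∀ c : Fin n → X, ∑ a : Fin n → X, (if ∏ i, m (c i) < (2 : ℝ) ^ be then
        (∏ i, l i (a i)) * Complex.normSq
          ((star (tens fun _ => W) * tens U : Matrix (Fin n → X) (Fin n → X) ℂ) c a) else 0) =
        if ∏ i, m (c i) < (2 : ℝ) ^ be then ∏ i, r i (c i) else 0 := by
      intro c
      split_ifs with h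
      · simp only [star_tens, tens_mul_tens, normSq_tens, ← Finset.prod_mul_distrib]
        exact sum_pi_prod fun i x => l i x * Complex.normSq ((star W * U i) (c i) x)
      · simp
    simp only [e]
    refine chebyshev_pi (Y := fun _ c => Real.logb 2 (m c)) hr_nonneg hr_sum hC' hδ hn _
      fun c hc hne => ?_
    have hmpos : ∀ i, m (c i) ≠ 0 := fun i h => hne i (hr0 i _ h)
    have hlt : ∑ i, Real.logb 2 (m (c i)) < be := by
      rw [← Real.logb_prod _ _ fun i _ => hmpos i]
      rw [← Real.logb_rpow h2 (by norm_num : (2 : ℝ) ≠ 1) (x := be)]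
      exact Real.logb_lt_logb one_lt_two
        (Finset.prod_pos fun i _ => (hm _).lt_of_ne' (hmpos i)) hc
    refine le_trans ?_ (neg_le_abs _)
    rw [Finset.sum_sub_distrib]
    rw [hbe] at hlt
    linarith
  linarith

end NShot

section Bipartite

variable {α β : Type*} [Fintype α] [Fintype β]

lemma trace_mul_kronecker_one [DecidableEq β] (τ : Matrix (α × β) (α × β) ℂ) (A : Matrix α α ℂ) :
    (τ * (A ⊗ₖ (1 : Matrix β β ℂ))).trace = (ptrR τ * A).trace := by
  simp only [Matrix.trace, Matrix.diag_apply, Matrix.mul_apply, Fintype.sum_prod_type, ptrR,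
    Matrix.of_apply, Matrix.kroneckerMap_apply, Matrix.one_apply, mul_ite, mul_one, mul_zero,
    Finset.sum_ite_eq', Finset.mem_univ, if_true, Finset.sum_mul]
  exact Finset.sum_congr rfl fun _ _ => Finset.sum_comm

lemma trace_mul_one_kronecker [DecidableEq α] (τ : Matrix (α × β) (α × β) ℂ) (A : Matrix β β ℂ) :
    (τ * ((1 : Matrix α α ℂ) ⊗ₖ A)).trace = (ptrL τ * A).trace := by
  simp only [Matrix.trace, Matrix.diag_apply, Matrix.mul_apply, Fintype.sum_prod_type, ptrL,
    Matrix.of_apply, Matrix.kroneckerMap_apply, Matrix.one_apply, ite_mul, zero_mul, one_mul,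
    mul_ite, mul_zero, Finset.sum_mul]
  rw [Finset.sum_comm]
  refine Finset.sum_congr rfl fun x _ => ?_
  rw [Finset.sum_comm]
  conv_rhs => rw [Finset.sum_comm]
  simp [Finset.sum_comm (s := (Finset.univ : Finset α))]

variable [DecidableEq α] [DecidableEq β]

lemma diagConj_kronecker (V : Matrix α α ℂ) (W : Matrix β β ℂ) (d : α → ℝ) (e : β → ℝ) :
    diagConj V d ⊗ₖ diagConj W e = diagConj (V ⊗ₖ W) fun c => d c.1 * e c.2 := by
  simp only [diagConj, Matrix.mul_kronecker_mul, Matrix.diagonal_kronecker_diagonal,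
    Matrix.star_eq_conjTranspose, Matrix.conjTranspose_kronecker, Complex.ofReal_mul]

lemma diagConj_one {U : Matrix α α ℂ} (hU : U ∈ Matrix.unitaryGroup α ℂ) :
    diagConj U (fun _ => 1) = 1 := by
  simp [diagConj, Matrix.mem_unitaryGroup_iff.1 hU]

lemma mul_logb_sq_le {x : ℝ} (h0 : 0 ≤ x) (h1 : x ≤ 1) :
    x * Real.logb 2 x ^ 2 ≤ 4 / Real.log 2 ^ 2 := by
  rcases h0.eq_or_lt with rfl | h
  · simp; positivity
  · have h2 := Real.abs_log_mul_self_rpow_lt x (1 / 2) h h1 (by norm_num)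
    rw [← Real.sqrt_eq_rpow] at h2
    have h3 := pow_le_pow_left₀ (abs_nonneg _) h2.le 2
    rw [sq_abs, mul_pow, Real.sq_sqrt h0] at h3
    rw [Real.logb, div_pow, ← mul_div_assoc]
    gcongr
    linarith

end Bipartite

section Marginals

variable {α β : Type*} [Fintype α] [Fintype β]

lemma ptrR_isState {τ : Matrix (α × β) (α × β) ℂ} (hτ : IsState τ) : IsState (ptrR τ) := by
  refine ⟨?_, ?_⟩
  · have : ptrR τ = ∑ b, τ.submatrix (fun a => (a, b)) (fun a => (a, b)) := by
      ext a a'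
      simp [ptrR, Matrix.sum_apply]
    rw [this]
    exact Matrix.posSemidef_sum _ fun b _ => hτ.1.submatrix _
  · rw [← hτ.2]
    simp [ptrR, Matrix.trace, Fintype.sum_prod_type]

lemma trace_ptrL (τ : Matrix (α × β) (α × β) ℂ) : (ptrL τ).trace = τ.trace := by
  simp only [ptrL, Matrix.trace, Matrix.diag_apply, Matrix.of_apply, Fintype.sum_prod_type]
  exact Finset.sum_comm

lemma ptrL_isState {τ : Matrix (α × β) (α × β) ℂ} (hτ : IsState τ) : IsState (ptrL τ) := by
  refine ⟨?_, ?_⟩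
  · have : ptrL τ = ∑ a, τ.submatrix (fun b => (a, b)) (fun b => (a, b)) := by
      ext b b'
      simp [ptrL, Matrix.sum_apply]
    rw [this]
    exact Matrix.posSemidef_sum _ fun b _ => hτ.1.submatrix _
  · rw [trace_ptrL, hτ.2]

variable [DecidableEq α] [DecidableEq β]

lemma sum_overlap_mul {ι : Type*} [Fintype ι] [DecidableEq ι] (U W : Matrix ι ι ℂ) (l e : ι → ℝ) :
    ∑ c, (∑ a, l a * Complex.normSq ((star W * U) c a)) * e c =
      (diagConj U l * diagConj W e).trace.re := by
  rw [trace_diagConj_mul, Complex.ofReal_re, Finset.sum_comm]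
  refine Finset.sum_congr rfl fun c _ => ?_
  rw [Finset.sum_mul]
  exact Finset.sum_congr rfl fun a _ => by ring

/-- Moments and support of the distribution obtained by measuring a bipartite state `τ` with
marginal `ω` in a product eigenbasis of `Y ⊗ ω`. -/
lemma exists_bipartite_overlap {Y : Matrix α α ℂ} (hY : IsState Y)
    (hYpos : ∀ i, 0 < hY.1.isHermitian.eigenvalues i) {ω : Matrix β β ℂ} (hω : IsState ω) :
    ∃ W ∈ Matrix.unitaryGroup (α × β) ℂ, ∃ m : α × β → ℝ, (∀ c, 0 ≤ m c) ∧
      Y ⊗ₖ ω = diagConj W m ∧ ∀ U : Matrix (α × β) (α × β) ℂ, ∀ l : α × β → ℝ, (∀ a, 0 ≤ l a) →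
        ptrL (diagConj U l) = ω →
        (∀ c, m c = 0 → ∑ a, l a * Complex.normSq ((star W * U) c a) = 0) ∧
        ∑ c, (∑ a, l a * Complex.normSq ((star W * U) c a)) * Real.logb 2 (m c) =
          (ptrR (diagConj U l) * matLog Y).trace.re - entropy ω := by
  obtain ⟨V, hV, hYV, hYlog⟩ := exists_diagConj hY.1.isHermitian
  obtain ⟨V', hV', hωV, hωlog⟩ := exists_diagConj hω.1.isHermitian
  set d := hY.1.isHermitian.eigenvalues with hd
  set e := hω.1.isHermitian.eigenvalues with he
  have he0 : ∀ i, 0 ≤ e i := (isState_eigenvalues hω).1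
  refine ⟨V ⊗ₖ V', Matrix.kronecker_mem_unitary hV hV', fun c => d c.1 * e c.2,
    fun c => mul_nonneg (hYpos _).le (he0 _), ?_, fun U l hl hU => ?_⟩
  · conv_lhs => rw [hYV, hωV]
    exact diagConj_kronecker V V' d e
  · set r : α × β → ℝ := fun c => ∑ a, l a * Complex.normSq ((star (V ⊗ₖ V') * U) c a) with hr
    have hr0 : ∀ c, 0 ≤ r c := fun c =>
      Finset.sum_nonneg fun a _ => mul_nonneg (hl a) (Complex.normSq_nonneg _)
    have hright : ∀ f : β → ℝ, ∑ c, r c * f c.2 = (ω * diagConj V' f).trace.re := by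
      intro f
      have := sum_overlap_mul U (V ⊗ₖ V') l fun c => 1 * f c.2
      rw [← diagConj_kronecker V V' (fun _ => 1) f, diagConj_one hV, trace_mul_one_kronecker,
        hU] at this
      simpa only [one_mul] using this
    have hleft : ∀ f : α → ℝ, ∑ c, r c * f c.1 =
        (ptrR (diagConj U l) * diagConj V f).trace.re := by
      intro f
      have := sum_overlap_mul U (V ⊗ₖ V') l fun c => f c.1 * 1
      rw [← diagConj_kronecker V V' f fun _ => 1, diagConj_one hV', trace_mul_kronecker_one] at this
      simpa only [mul_one] using this
    have hsupp : ∀ c, d c.1 * e c.2 = 0 → r c = 0 := by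
      intro c hc
      have hec : e c.2 = 0 := (mul_eq_zero.1 hc).resolve_left (hYpos _).ne'
      have h1 := hright fun b => if b = c.2 then 1 else 0
      rw [hωV, diagConj_mul_diagConj hV', trace_diagConj hV', Complex.ofReal_re] at h1
      have h2 : ∑ i, e i * (if i = c.2 then (1 : ℝ) else 0) = 0 := by simp [hec]
      rw [h2] at h1
      have h3 := (Finset.sum_eq_zero_iff_of_nonneg fun c' _ => mul_nonneg (hr0 c')
        (by split_ifs <;> norm_num)).1 h1 c (Finset.mem_univ c)
      simpa using h3
    refine ⟨hsupp, ?_⟩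
    have hsplit : ∀ c, r c * Real.logb 2 (d c.1 * e c.2) =
        r c * Real.logb 2 (d c.1) + r c * Real.logb 2 (e c.2) := by
      intro c
      by_cases h : e c.2 = 0
      · rw [hsupp c (by rw [h, mul_zero])]; ring
      · rw [Real.logb_mul (hYpos _).ne' h, mul_add]
    have h1 := hleft fun a => Real.logb 2 (d a)
    have h2 := hright fun b => Real.logb 2 (e b)
    change ∑ c, r c * Real.logb 2 (d c.1 * e c.2) = _
    rw [Finset.sum_congr rfl fun c _ => hsplit c, Finset.sum_add_distrib, h1, h2, entropy, sub_neg_eq_add]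
    have e1 : matLog Y = diagConj V fun a => Real.logb 2 (d a) := hYlog
    have e2 : matLog ω = diagConj V' fun a => Real.logb 2 (e a) := hωlog
    rw [e1, e2]

end Marginals

section PermProd

variable {B EB : Type*} {n : ℕ}

/-- The bijection regrouping `(B × EB)^n` as `B^n × EB^n` with the `B^n` factors permuted. -/
def permRegroup (B EB : Type*) (π : Equiv.Perm (Fin n)) :
    (Fin n → B) × (Fin n → EB) ≃ (Fin n → B × EB) where
  toFun p i := (p.1 (π i), p.2 i)
  invFun f := (fun i => (f (π.symm i)).1, fun i => (f i).2)
  left_inv p := by simp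
  right_inv f := by simp

lemma permProdState_eq (π : Equiv.Perm (Fin n)) (τ : Fin n → Matrix (B × EB) (B × EB) ℂ) :
    permProdState π τ = (tens τ).submatrix (permRegroup B EB π) (permRegroup B EB π) := rfl

/-- A product of identical product states does not notice the permutation. -/
lemma permProdState_kronecker (π : Equiv.Perm (Fin n)) (Y : Matrix B B ℂ) (ω : Matrix EB EB ℂ) :
    permProdState π (fun _ => Y ⊗ₖ ω) = prodState fun _ => Y ⊗ₖ ω := by
  ext p q
  simp only [permProdState, prodState, Matrix.of_apply, Matrix.kroneckerMap_apply,
    Finset.prod_mul_distrib]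
  rw [Equiv.prod_comp π fun i => Y (p.1 i) (q.1 i)]

lemma trace_submatrix_equiv {ι κ : Type*} [Fintype ι] [Fintype κ] (e : ι ≃ κ)
    (A : Matrix κ κ ℂ) : (A.submatrix e e).trace = A.trace := by
  simp only [Matrix.trace, Matrix.diag_apply, Matrix.submatrix_apply]
  exact Equiv.sum_comp e fun i => A i i

lemma trace_mul_submatrix_equiv {ι κ : Type*} [Fintype ι] [Fintype κ] (e : ι ≃ κ)
    (Λ : Matrix ι ι ℂ) (A : Matrix κ κ ℂ) :
    (Λ * A.submatrix e e).trace = (Λ.submatrix e.symm e.symm * A).trace := by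
  rw [← trace_submatrix_equiv e (Λ.submatrix e.symm e.symm * A),
    ← Matrix.submatrix_mul_equiv _ _ _ e]
  simp

variable [Fintype B] [Fintype EB]

lemma trace_permProdState (π : Equiv.Perm (Fin n))
    (τ : Fin n → Matrix (B × EB) (B × EB) ℂ) :
    (permProdState π τ).trace = ∏ i, (τ i).trace := by
  rw [← trace_tens]
  exact trace_submatrix_equiv (permRegroup B EB π) (tens τ)

lemma trace_prodState (τ : Fin n → Matrix (B × EB) (B × EB) ℂ) :
    (prodState τ).trace = ∏ i, (τ i).trace :=
  trace_permProdState 1 τ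

variable [DecidableEq B] [DecidableEq EB]

/-- Probability of an outcome on a permuted product of states sharing the marginal `ω`, compared
with its probability on the reference `(Y ⊗ ω)^{⊗n}`. -/
lemma exists_trace_mul_permProdState_le {Y : Matrix B B ℂ} (hY : IsState Y)
    (hYpos : ∀ i, 0 < hY.1.isHermitian.eigenvalues i) {ω : Matrix EB EB ℂ} (hω : IsState ω) :
    ∃ C : ℝ, ∀ (n : ℕ) (δ : ℝ) (π : Equiv.Perm (Fin n)) (τ : Fin n → Matrix (B × EB) (B × EB) ℂ)
      (Λ : Matrix ((Fin n → B) × (Fin n → EB)) ((Fin n → B) × (Fin n → EB)) ℂ),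
      0 < δ → 0 < n → (∀ i, IsState (τ i)) → (∀ i, ptrL (τ i) = ω) → Λ.PosSemidef →
      (1 - Λ).PosSemidef → (Λ * permProdState π τ).trace.re ≤
        2 * (2 : ℝ) ^ (∑ i, (entropy ω - (ptrR (τ i) * matLog Y).trace.re - entropy (τ i)) +
          2 * (n * δ)) * (Λ * prodState fun _ => Y ⊗ₖ ω).trace.re + 3 * (C / (n * δ ^ 2)) := by
  obtain ⟨W, hW, m, hm, hWm, hov⟩ := exists_bipartite_overlap hY hYpos hω
  refine ⟨Fintype.card (B × EB) * (4 / Real.log 2 ^ 2) + ∑ c, Real.logb 2 (m c) ^ 2,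
    fun n δ π τ Λ hδ hn hτ hτω hΛ hΛ1 => ?_⟩
  choose U hU hτU _ using fun i => exists_diagConj (hτ i).1.isHermitian
  set l : Fin n → B × EB → ℝ := fun i => (hτ i).1.isHermitian.eigenvalues with hl
  have hl0 : ∀ i a, 0 ≤ l i a := fun i => (isState_eigenvalues (hτ i)).1
  have hl1 : ∀ i, ∑ a, l i a = 1 := fun i => (isState_eigenvalues (hτ i)).2
  have hτU' : τ = fun i => diagConj (U i) (l i) := funext hτU
  have hov' := fun i => hov (U i) (l i) (hl0 i) (by rw [← hτω i]; exact congrArg ptrL (hτU i).symm)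
  set e := permRegroup B EB π with he
  have hpos : (Λ.submatrix e.symm e.symm).PosSemidef := hΛ.submatrix _
  have hpos1 : (1 - Λ.submatrix e.symm e.symm).PosSemidef := by
    rw [← Matrix.submatrix_one_equiv e.symm]
    exact hΛ1.submatrix e.symm
  have hr0 : ∀ i c, 0 ≤ ∑ a, l i a * Complex.normSq ((star W * U i) c a) := fun i c =>
    Finset.sum_nonneg fun a _ => mul_nonneg (hl0 i a) (Complex.normSq_nonneg _)
  have hr1 : ∀ i c, ∑ a, l i a * Complex.normSq ((star W * U i) c a) ≤ 1 := by
    intro i c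
    rw [← sum_normSq_row (star_mul_mem_unitaryGroup (hU i) hW) c]
    refine Finset.sum_le_sum fun a _ => ?_
    exact mul_le_of_le_one_left (Complex.normSq_nonneg _) (eigenvalues_le_one (hτ i) a)
  have key := trace_mul_tens_le hU hW hl0 hl1 hm (fun i => (hov' i).1)
    (C := Fintype.card (B × EB) * (4 / Real.log 2 ^ 2) + ∑ c, Real.logb 2 (m c) ^ 2)
    (fun i => ?_) (fun i => ?_) hδ hn hpos hpos1
  · have h1 : (Λ * permProdState π τ).trace =
        (Λ.submatrix e.symm e.symm * tens fun i => diagConj (U i) (l i)).trace := by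
      rw [permProdState_eq, trace_mul_submatrix_equiv, ← hτU']
    have h2 : (Λ * prodState fun _ : Fin n => Y ⊗ₖ ω).trace =
        (Λ.submatrix e.symm e.symm * tens fun _ => diagConj W m).trace := by
      rw [← permProdState_kronecker π, permProdState_eq, trace_mul_submatrix_equiv, hWm]
    rw [h1, h2]
    convert key using 7 with i
    rw [(hov' i).2, ← hτU i]
    have : entropy (τ i) = -∑ a, l i a * Real.logb 2 (l i a) :=
      entropy_eq_sum_eigenvalues (hτ i).1.isHermitian
    rw [this]; ring
  · have h1 : ∑ a, l i a * Real.logb 2 (l i a) ^ 2 ≤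
        ∑ a : B × EB, 4 / Real.log 2 ^ 2 := Finset.sum_le_sum fun a _ =>
      mul_logb_sq_le (hl0 i a) (eigenvalues_le_one (hτ i) a)
    rw [Finset.sum_const, Finset.card_univ, nsmul_eq_mul] at h1
    have h2 : 0 ≤ ∑ c, Real.logb 2 (m c) ^ 2 := Finset.sum_nonneg fun _ _ => sq_nonneg _
    linarith
  · have h1 : ∑ c, (∑ a, l i a * Complex.normSq ((star W * U i) c a)) * Real.logb 2 (m c) ^ 2 ≤
        ∑ c, Real.logb 2 (m c) ^ 2 := Finset.sum_le_sum fun c _ =>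
      mul_le_of_le_one_left (sq_nonneg _) (hr1 i c)
    have h2 : 0 ≤ (Fintype.card (B × EB) : ℝ) * (4 / Real.log 2 ^ 2) := by positivity
    linarith

end PermProd

section ClassicalQuantum

variable {ι γ : Type*} [Fintype ι] [DecidableEq ι] [Fintype γ] [DecidableEq γ]

lemma cqState_diagConj (p : ι → ℝ) (U : ι → Matrix γ γ ℂ) (l : ι → γ → ℝ) :
    cqState p (fun x => diagConj (U x) (l x)) =
      diagConj (Matrix.of fun a b : ι × γ => if a.1 = b.1 then U a.1 a.2 b.2 else 0)
        fun c => p c.1 * l c.1 c.2 := by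
  ext ⟨x, a⟩ ⟨y, b⟩
  rw [diagConj_apply, Fintype.sum_prod_type]
  simp only [cqState, Matrix.of_apply, ite_mul, zero_mul]
  rw [Finset.sum_eq_single x (fun z _ hz => by simp [hz.symm]) (by simp)]
  by_cases h : x = y
  · subst h
    simp only [if_true, diagConj_apply, Finset.mul_sum]
    exact Finset.sum_congr rfl fun k _ => by push_cast; ring
  · simp [h, Ne.symm h]

lemma cq_blockDiag_mem_unitaryGroup {U : ι → Matrix γ γ ℂ}
    (hU : ∀ x, U x ∈ Matrix.unitaryGroup γ ℂ) :
    (Matrix.of fun a b : ι × γ => if a.1 = b.1 then U a.1 a.2 b.2 else 0) ∈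
      Matrix.unitaryGroup (ι × γ) ℂ := by
  rw [Matrix.mem_unitaryGroup_iff]
  have h := cqState_diagConj (fun _ => 1) U fun _ _ => 1
  simp only [diagConj_one (hU _)] at h
  have h2 : ∀ V : Matrix (ι × γ) (ι × γ) ℂ, diagConj V (fun _ => 1 * 1) = V * star V := by
    intro V; simp [diagConj]
  rw [h2] at h
  rw [← h]
  ext ⟨x, a⟩ ⟨y, b⟩
  simp only [cqState, Matrix.of_apply, Matrix.one_apply, Prod.mk.injEq]
  split_ifs <;> simp_all

/-- Entropy of a classical-quantum state. -/
lemma entropy_cqState {p : ι → ℝ} {σ : ι → Matrix γ γ ℂ} (hσ : ∀ x, IsState (σ x)) :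
    entropy (cqState p σ) = -∑ x, p x * Real.logb 2 (p x) + ∑ x, p x * entropy (σ x) := by
  choose U hU hσU _ using fun x => exists_diagConj (hσ x).1.isHermitian
  set l : ι → γ → ℝ := fun x => (hσ x).1.isHermitian.eigenvalues with hl
  have hl1 : ∀ x, ∑ a, l x a = 1 := fun x => (isState_eigenvalues (hσ x)).2
  have hσU' : σ = fun x => diagConj (U x) (l x) := funext hσU
  have hS : ∀ x, entropy (σ x) = -∑ a, l x a * Real.logb 2 (l x a) := fun x =>
    entropy_eq_sum_eigenvalues (hσ x).1.isHermitian
  simp only [hS]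
  conv_lhs => rw [hσU']
  rw [cqState_diagConj, entropy_diagConj (cq_blockDiag_mem_unitaryGroup hU),
    Fintype.sum_prod_type, ← Finset.sum_neg_distrib, ← Finset.sum_neg_distrib,
    ← Finset.sum_add_distrib]
  refine Finset.sum_congr rfl fun x _ => ?_
  have h : ∀ a, p x * l x a * Real.logb 2 (p x * l x a) =
      p x * Real.logb 2 (p x) * l x a + p x * (l x a * Real.logb 2 (l x a)) := by
    intro a
    by_cases h1 : p x = 0
    · simp [h1]
    by_cases h2 : l x a = 0
    · simp [h2]
    rw [Real.logb_mul h1 h2]; ring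
  simp only [h, Finset.sum_add_distrib, ← Finset.mul_sum, hl1]
  ring

end ClassicalQuantum

section Channels

variable {α β γ : Type*} [Fintype α] [DecidableEq α] [Fintype β] [DecidableEq β]

lemma rTensor_posSemidef [Fintype γ] (N : QChannel α β) {ρ : Matrix (α × γ) (α × γ) ℂ} (hρ : ρ.PosSemidef) :
    (rTensor γ N.map ρ).PosSemidef := by
  let e := Fintype.equivFin γ
  have h := N.cp (Fintype.card γ) (ρ.submatrix (fun p => (p.2, e.symm p.1))
    fun p => (p.2, e.symm p.1)) (hρ.submatrix _)
  have h2 := h.submatrix fun q : β × γ => (e q.2, q.1)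
  convert h2 using 1
  ext p q
  simp [rTensor, lTensor]

lemma ptrL_rTensor (N : QChannel α β) (ρ : Matrix (α × γ) (α × γ) ℂ) :
    ptrL (rTensor γ N.map ρ) = ptrL ρ := by
  ext c c'
  exact N.tp (Matrix.of fun a a' => ρ (a, c) (a', c'))

end Channels

section AssistedStates

variable {EA EB A B : Type*} [Fintype EA] [DecidableEq EA]
  [Fintype A] [DecidableEq A] [Fintype B] [DecidableEq B]

lemma ptrL_assistedOut (N : QChannel A B) (E : QChannel EA A)
    (ρ : Matrix (EA × EB) (EA × EB) ℂ) : ptrL (assistedOut N E ρ) = ptrL ρ :=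
  (ptrL_rTensor N (rTensor EB E.map ρ)).trans (ptrL_rTensor E ρ)

variable [Fintype EB] [DecidableEq EB]

lemma assistedOut_isState (N : QChannel A B) (E : QChannel EA A)
    {ρ : Matrix (EA × EB) (EA × EB) ℂ} (hρ : IsState ρ) : IsState (assistedOut N E ρ) := by
  refine ⟨rTensor_posSemidef N (rTensor_posSemidef E hρ.1), ?_⟩
  rw [← trace_ptrL, ptrL_assistedOut, trace_ptrL, hρ.2]

lemma infoXE_B_assistedCQ (N : QChannel A B) {ρ : Matrix (EA × EB) (EA × EB) ℂ} (hρ : IsState ρ)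
    {n : ℕ} (p : Fin n → ℝ) (hp : IsProbDist p) (E : Fin n → QChannel EA A) :
    infoXE_B (assistedCQ N ρ p E) = entropy (ptrL ρ) +
      (entropy (∑ x, (p x : ℂ) • ptrR (assistedOut N (E x) ρ)) -
        ∑ x, p x * entropy (assistedOut N (E x) ρ)) := by
  have h1 : margXE (assistedCQ N ρ p E) = cqState p fun _ => ptrL ρ := by
    have : (cqState p fun _ => ptrL ρ) = cqState p fun x => ptrL (assistedOut N (E x) ρ) := by
      simp only [ptrL_assistedOut]
    rw [this]
    ext ⟨x, a⟩ ⟨y, b⟩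
    simp only [margXE, assistedCQ, cqState, Matrix.of_apply, ptrL]
    split_ifs
    · rw [Finset.mul_sum]
    · simp
  have h2 : ptrR (ptrL (assistedCQ N ρ p E)) =
      ∑ x, (p x : ℂ) • ptrR (assistedOut N (E x) ρ) := by
    ext a b
    simp only [ptrR, ptrL, assistedCQ, cqState, Matrix.of_apply, if_true, Matrix.sum_apply,
      Matrix.smul_apply, smul_eq_mul, Finset.mul_sum]
    exact Finset.sum_comm
  have hω : IsState (ptrL ρ) := ptrL_isState hρ
  rw [infoXE_B, h1, h2, assistedCQ, entropy_cqState fun _ => hω,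
    entropy_cqState fun x => assistedOut_isState N (E x) hρ, ← Finset.sum_mul, hp.2]
  ring

end AssistedStates

section Converse

variable {EA EB A B : Type*} [Fintype EA] [DecidableEq EA] [Fintype EB] [DecidableEq EB]
  [Fintype A] [DecidableEq A] [Fintype B] [DecidableEq B]

lemma trace_mul_re_nonneg {ι : Type*} [Fintype ι] [DecidableEq ι] {X Y : Matrix ι ι ℂ}
    (hX : X.PosSemidef) (hY : Y.PosSemidef) : 0 ≤ (X * Y).trace.re := by
  obtain ⟨U, -, hYU, -⟩ := exists_diagConj hY.isHermitian
  rw [hYU, trace_mul_diagConj]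
  exact Finset.sum_nonneg fun a _ => mul_nonneg (hY.eigenvalues_nonneg a)
    (Complex.le_def.1 ((hX.conjTranspose_mul_mul_same U).diag_nonneg (i := a))).1

lemma IsState.nonempty {ι : Type*} [Fintype ι] {X : Matrix ι ι ℂ} (hX : IsState X) :
    Nonempty ι := by
  by_contra h
  rw [not_nonempty_iff] at h
  have := hX.2
  simp [Matrix.trace] at this

lemma infoXE_B_le_assistedMutualS (N : QChannel A B) {ρ : Matrix (EA × EB) (EA × EB) ℂ}
    (hρ : IsState ρ) {n : ℕ} (p : Fin n → ℝ) (hp : IsProbDist p) (E : Fin n → QChannel EA A) :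
    infoXE_B (assistedCQ N ρ p E) ≤ assistedMutualS N ρ := by
  refine le_csSup ⟨entropy (ptrL ρ) + Fintype.card B / Real.log 2, ?_⟩ ⟨n, p, E, hp, rfl⟩
  rintro _ ⟨k, q, F, hq, rfl⟩
  rw [infoXE_B_assistedCQ N hρ q hq]
  have h1 := entropy_le (sum_smul_isState hq
    fun x => ptrR_isState (assistedOut_isState N (F x) hρ))
  have h2 : 0 ≤ ∑ x, q x * entropy (assistedOut N (F x) ρ) := Finset.sum_nonneg fun x _ =>
    mul_nonneg (hq.1 x) (entropy_nonneg (assistedOut_isState N (F x) hρ))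
  linarith

/-- Finite-blocklength converse: bound on the success probability of a semi-global code. -/
lemma exists_one_sub_error_le [Nonempty (QChannel EA A)] (N : QChannel A B)
    {ρ : Matrix (EA × EB) (EA × EB) ℂ} (hρ : IsState ρ) {θ : ℝ} (hθ : 0 < θ) :
    ∃ C : ℝ, ∀ (n M : ℕ) (ε : ℝ), 0 < n → SemiGlobalCode N ρ n M ε → 0 < M ∧
      1 - ε ≤ 2 * (2 : ℝ) ^ (n * (assistedMutualS N ρ + 3 * θ)) / M + 3 * (C / (n * θ ^ 2)) := by
  obtain ⟨E₀⟩ := ‹Nonempty (QChannel EA A)›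
  have : Nonempty (QChannel EA A) := ⟨E₀⟩
  have hst := fun E : QChannel EA A => assistedOut_isState N E hρ
  have : Nonempty B := (ptrR_isState (hst E₀)).nonempty
  have : Nonempty EB := (ptrL_isState hρ).nonempty
  obtain ⟨Y, hY, hYpos, hYE⟩ := exists_common_reference
    (fun E : QChannel EA A => ptrR (assistedOut N E ρ)) (fun E => ptrR_isState (hst E))
    (fun E => entropy (assistedOut N E ρ)) (assistedMutualS N ρ - entropy (ptrL ρ))
    (fun n p E hp => by
      have := infoXE_B_le_assistedMutualS N hρ p hp E
      rw [infoXE_B_assistedCQ N hρ p hp] at this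
      linarith) hθ
  obtain ⟨C, hC⟩ := exists_trace_mul_permProdState_le hY hYpos (ptrL_isState hρ)
  refine ⟨C, fun n M ε hn ⟨Enc, perm, Λ, hΛ, hΛ1, herr⟩ => ?_⟩
  have hM : 0 < M := by
    rcases Nat.eq_zero_or_pos M with rfl | h
    · rw [Finset.univ_eq_empty, Finset.sum_empty] at hΛ1
      exact absurd hΛ1 zero_ne_one
    · exact h
  refine ⟨hM, ?_⟩
  have hM' : (0 : ℝ) < M := by exact_mod_cast hM
  have hn' : (0 : ℝ) < n := by exact_mod_cast hn
  set ω := fun m => permProdState (perm m) fun i => assistedOut N (Enc m i) ρ with hω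
  set σ : Matrix ((Fin n → B) × (Fin n → EB)) ((Fin n → B) × (Fin n → EB)) ℂ :=
    prodState fun _ => Y ⊗ₖ ptrL ρ with hσ
  have hσtr : σ.trace = 1 := by
    rw [hσ, trace_prodState]
    simp [Matrix.trace_kronecker, hY.2, (ptrL_isState hρ).2]
  have hσpos : σ.PosSemidef := by
    have : σ = (tens fun _ => Y ⊗ₖ ptrL ρ).submatrix (permRegroup B EB 1) (permRegroup B EB 1) :=
      rfl
    obtain ⟨W, hW, m, hm, hWm, -⟩ := exists_bipartite_overlap hY hYpos (ptrL_isState hρ)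
    rw [this, hWm, tens_diagConj]
    refine Matrix.PosSemidef.submatrix ?_ _
    rw [diagConj, Matrix.star_eq_conjTranspose]
    refine (Matrix.posSemidef_diagonal_iff.2 fun c => ?_).mul_mul_conjTranspose_same _
    exact_mod_cast Finset.prod_nonneg fun i _ => hm _
  have hle1 : ∀ m, (1 - Λ m).PosSemidef := by
    intro m
    rw [← hΛ1, ← Finset.add_sum_erase _ _ (Finset.mem_univ m), add_sub_cancel_left]
    exact Matrix.posSemidef_sum _ fun k _ => hΛ k
  have hnn : ∀ m, 0 ≤ (Λ m * σ).trace.re := fun m => trace_mul_re_nonneg (hΛ m) hσpos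
  set K : ℝ := 2 * (2 : ℝ) ^ (n * (assistedMutualS N ρ + 3 * θ)) with hK
  have hm : ∀ m, (Λ m * ω m).trace.re ≤ K * (Λ m * σ).trace.re + 3 * (C / (n * θ ^ 2)) := by
    intro m
    refine (hC n θ (perm m) _ (Λ m) hθ hn (fun i => hst (Enc m i))
      (fun i => ptrL_assistedOut N (Enc m i) ρ) (hΛ m) (hle1 m)).trans ?_
    gcongr ?_ + _
    refine mul_le_mul_of_nonneg_right ?_ (hnn m)
    rw [hK]
    gcongr
    · norm_num
    · have : ∑ i, (entropy (ptrL ρ) - (ptrR (assistedOut N (Enc m i) ρ) * matLog Y).trace.re -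
          entropy (assistedOut N (Enc m i) ρ)) ≤ ∑ _i : Fin n, (assistedMutualS N ρ + θ) :=
        Finset.sum_le_sum fun i _ => by
          have := hYE (Enc m i)
          linarith
      rw [Finset.sum_const, Finset.card_univ, Fintype.card_fin, nsmul_eq_mul] at this
      linarith
  have hsum : ∑ m, (Λ m * σ).trace.re = 1 := by
    rw [← Complex.re_sum, ← Matrix.trace_sum, ← Finset.sum_mul, hΛ1, Matrix.one_mul, hσtr,
      Complex.one_re]
  have htot := Finset.sum_le_sum fun m (_ : m ∈ Finset.univ) => hm m
  rw [Finset.sum_add_distrib, ← Finset.mul_sum, hsum, Finset.sum_const, Finset.card_univ,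
    Fintype.card_fin, nsmul_eq_mul, mul_one] at htot
  have hωtr : ∀ m, ((1 - Λ m) * ω m).trace.re = 1 - (Λ m * ω m).trace.re := by
    intro m
    rw [Matrix.sub_mul, Matrix.one_mul, Matrix.trace_sub, Complex.sub_re, hω,
      trace_permProdState]
    simp [(hst _).2]
  rw [avgErr] at herr
  change 1 / (M : ℝ) * ∑ m, ((1 - Λ m) * ω m).trace.re ≤ ε at herr
  simp only [hωtr, Finset.sum_sub_distrib, Finset.sum_const, Finset.card_univ,
    Fintype.card_fin, nsmul_eq_mul, mul_one] at herr
  rw [one_div, inv_mul_le_iff₀ hM'] at herr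
  have : M * (1 - ε) ≤ M * (K / M + 3 * (C / (n * θ ^ 2))) := by
    rw [mul_add, mul_div_cancel₀ _ hM'.ne']
    linarith
  exact le_of_mul_le_mul_left this hM'

lemma assistedMutualS_eq_zero [IsEmpty (QChannel EA A)] (N : QChannel A B)
    (ρ : Matrix (EA × EB) (EA × EB) ℂ) : assistedMutualS N ρ = 0 := by
  have : { r | ∃ (n : ℕ) (p : Fin n → ℝ) (E : Fin n → QChannel EA A),
      IsProbDist p ∧ r = infoXE_B (assistedCQ N ρ p E) } = ∅ := by
    rw [Set.eq_empty_iff_forall_notMem]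
    rintro _ ⟨n, p, E, hp, -⟩
    rcases n with _ | n
    · simpa using hp.2
    · exact isEmptyElim (E 0)
  rw [assistedMutualS, this, Real.sSup_empty]

lemma semiGlobalAchievable_le_zero [IsEmpty (QChannel EA A)] {N : QChannel A B}
    {ρ : Matrix (EA × EB) (EA × EB) ℂ} {ε R : ℝ} (hR : SemiGlobalAchievable N ρ ε R) : R ≤ 0 := by
  refine le_of_forall_pos_le_add fun δ hδ => ?_
  obtain ⟨n₀, h⟩ := hR δ hδ
  obtain ⟨M, hM, Enc, -⟩ := h (n₀ + 1) (Nat.le_succ _)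
  rcases M with _ | M
  · simp only [Nat.cast_zero, Real.logb_zero, zero_div] at hM
    linarith
  · exact isEmptyElim (Enc 0 0)

lemma semiGlobalAchievable_zero [Nonempty (QChannel EA A)] (N : QChannel A B)
    (ρ : Matrix (EA × EB) (EA × EB) ℂ) {ε : ℝ} (hε : 0 ≤ ε) : SemiGlobalAchievable N ρ ε 0 := by
  refine fun δ hδ => ⟨0, fun n _ => ⟨1, by simp [hδ.le], fun _ _ => Classical.arbitrary _,
    fun _ => 1, fun _ => 1, fun _ => Matrix.PosSemidef.one, by simp, by simpa [avgErr] using hε⟩⟩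

lemma semiGlobalAchievable_le [Nonempty (QChannel EA A)] {N : QChannel A B}
    {ρ : Matrix (EA × EB) (EA × EB) ℂ} (hρ : IsState ρ) {ε R : ℝ} (hε : ε < 1)
    (hR : SemiGlobalAchievable N ρ ε R) : R ≤ assistedMutualS N ρ := by
  by_contra! hlt
  set I := assistedMutualS N ρ with hI
  set θ := (R - I) / 8 with hθ
  have hθ0 : 0 < θ := by rw [hθ]; linarith
  obtain ⟨C, hC⟩ := exists_one_sub_error_le N hρ hθ0
  obtain ⟨n₀, hn₀⟩ := hR θ hθ0
  have hbound : ∀ n : ℕ, max n₀ 1 ≤ n →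
      1 - ε ≤ 2 * ((2 : ℝ) ^ (-4 * θ)) ^ n + 3 * (C / θ ^ 2 / n) := by
    intro n hn
    have hn1 : 0 < n := lt_of_lt_of_le one_pos ((le_max_right _ _).trans hn)
    have hn' : (0 : ℝ) < n := by exact_mod_cast hn1
    obtain ⟨M, hMR, hcode⟩ := hn₀ n ((le_max_left _ _).trans hn)
    obtain ⟨hM, hb⟩ := hC n M ε hn1 hcode
    have hM' : (0 : ℝ) < M := by exact_mod_cast hM
    rw [le_div_iff₀ hn'] at hMR
    have hMge : (2 : ℝ) ^ ((R - θ) * n) ≤ M := by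
      rwa [Real.le_logb_iff_rpow_le one_lt_two hM'] at hMR
    refine hb.trans ?_
    have e1 : C / (n * θ ^ 2) = C / θ ^ 2 / n := by field_simp
    rw [e1]
    gcongr ?_ + _
    rw [mul_div_assoc]
    gcongr 2 * ?_
    rw [div_le_iff₀ hM', ← Real.rpow_natCast, ← Real.rpow_mul zero_le_two]
    calc (2 : ℝ) ^ (n * (I + 3 * θ)) = 2 ^ (-4 * θ * n) * 2 ^ ((R - θ) * n) := by
          rw [← Real.rpow_add two_pos]
          congr 1
          rw [hθ]; ring
      _ ≤ _ := by gcongr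
  have hlim : Filter.Tendsto
      (fun n : ℕ => 2 * ((2 : ℝ) ^ (-4 * θ)) ^ n + 3 * (C / θ ^ 2 / n)) Filter.atTop (nhds 0) := by
    have h1 : Filter.Tendsto (fun n : ℕ => ((2 : ℝ) ^ (-4 * θ)) ^ n) Filter.atTop (nhds 0) :=
      tendsto_pow_atTop_nhds_zero_of_lt_one (by positivity)
        (Real.rpow_lt_one_of_one_lt_of_neg one_lt_two (by linarith))
    have h2 := tendsto_const_div_atTop_nhds_zero_nat (C / θ ^ 2)
    simpa using (h1.const_mul 2).add (h2.const_mul 3)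
  have := ge_of_tendsto hlim (Filter.eventually_atTop.2 ⟨_, hbound⟩)
  linarith

end Converse

/-- strong converse bound for semi-global encodings:
`C^{π,ε}_ρ(N) ≤ I_ρ(N)` for every (possibly mixed) assistance state `ρ` and
every `ε ∈ [0,1)`. -/
theorem semi_global_strong_converse
    {EA EB A B : Type*} [Fintype EA] [DecidableEq EA] [Fintype EB] [DecidableEq EB]
    [Fintype A] [DecidableEq A] [Fintype B] [DecidableEq B]
    (N : QChannel A B) (ρ : Matrix (EA × EB) (EA × EB) ℂ) (hρ : IsState ρ)
    (ε : ℝ) (hε : ε ∈ Set.Ico (0 : ℝ) 1) :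
    semiGlobalCapacity N ρ ε ≤ assistedMutualS N ρ := by
  rcases isEmpty_or_nonempty (QChannel EA A) with h | h
  · rw [assistedMutualS_eq_zero]
    exact Real.sSup_le (fun R hR => semiGlobalAchievable_le_zero hR) le_rfl
  · exact csSup_le ⟨0, semiGlobalAchievable_zero N ρ hε.1⟩
      fun R hR => semiGlobalAchievable_le hρ hε.2 hR

end QIT
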